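/- arXiv:1012.5171 — 7 statements merged into one kernel-verified Lean document; each statement's English description precedes it below -/
import Mathlib

section
/- Let f : [0,∞) → [0,∞) be a concave function and let H = [[A, X],[X*, B]] be an (n+m)×(n+m) positive semidefinite complex matrix written in blocks with A ∈ M_n(ℂ) and B ∈ M_m(ℂ). Then for every symmetric norm ‖·‖ on M_{n+m}(ℂ), ‖f(H)‖ ≤ ‖f(A) ⊕ 0_m‖ + ‖f(B) ⊕ 0_n‖, where f(A) ⊕ 0_m and f(B) ⊕ 0_n denote the (n+m)×(n+m) matrices obtained by padding f(A) and f(B) with zero blocks. -/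
open scoped Matrix ComplexOrder

/-- A symmetric (unitarily invariant) norm on square complex matrices indexed by `k`. -/
def IsSymmetricNorm {k : Type*} [Fintype k] [DecidableEq k]
    (N : Matrix k k ℂ → ℝ) : Prop :=
  (∀ A B : Matrix k k ℂ, N (A + B) ≤ N A + N B) ∧
  (∀ (c : ℂ) (A : Matrix k k ℂ), N (c • A) = ‖c‖ * N A) ∧
  (∀ A : Matrix k k ℂ, N A = 0 → A = 0) ∧
  (∀ (A U V : Matrix k k ℂ), U ∈ Matrix.unitaryGroup k ℂ →
    V ∈ Matrix.unitaryGroup k ℂ → N (U * A * V) = N A)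

namespace Matrix

theorem star_dotProduct_self_eq_sum_norm_sq {n : Type*} [Fintype n] (x : n → ℂ) :
    star x ⬝ᵥ x = ((∑ j, ‖x j‖ ^ 2 : ℝ) : ℂ) := by
  simp [dotProduct, Complex.conj_mul']

variable {k n : Type*} [Fintype k] [Fintype n] [DecidableEq n]

theorem sum_norm_sq_mulVec_of_isometry {J : Matrix k n ℂ} (hJ : Jᴴ * J = 1) (x : n → ℂ) :
    ∑ j, ‖(J *ᵥ x) j‖ ^ 2 = ∑ j, ‖x j‖ ^ 2 := by
  have h : star (J *ᵥ x) ⬝ᵥ (J *ᵥ x) = star x ⬝ᵥ x := by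
    rw [star_mulVec, ← dotProduct_mulVec, mulVec_mulVec, hJ, one_mulVec]
  rw [star_dotProduct_self_eq_sum_norm_sq, star_dotProduct_self_eq_sum_norm_sq] at h
  exact_mod_cast h

theorem fromRows_one_zero_conj {l : Type*} (M : Matrix n n ℂ) :
    fromRows (1 : Matrix n n ℂ) (0 : Matrix l n ℂ) * M *
      (fromRows (1 : Matrix n n ℂ) (0 : Matrix l n ℂ))ᴴ = fromBlocks M 0 0 0 := by
  rw [conjTranspose_fromRows_eq_fromCols_conjTranspose, fromRows_mul, fromRows_mul_fromCols]
  simp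

theorem fromRows_zero_one_conj {l : Type*} (M : Matrix n n ℂ) :
    fromRows (0 : Matrix l n ℂ) (1 : Matrix n n ℂ) * M *
      (fromRows (0 : Matrix l n ℂ) (1 : Matrix n n ℂ))ᴴ = fromBlocks 0 0 0 M := by
  rw [conjTranspose_fromRows_eq_fromCols_conjTranspose, fromRows_mul, fromRows_mul_fromCols]
  simp

theorem IsHermitian.cfc_eq_mul_diagonal_mul {A : Matrix n n ℂ} (hA : A.IsHermitian) (f : ℝ → ℝ) :
    cfc f A = (hA.eigenvectorUnitary : Matrix n n ℂ) *
      diagonal (fun i => ((f (hA.eigenvalues i) : ℝ) : ℂ)) *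
      (hA.eigenvectorUnitary : Matrix n n ℂ)ᴴ := by
  rw [hA.cfc_eq, IsHermitian.cfc, Unitary.conjStarAlgAut_apply]
  rfl

theorem IsHermitian.eq_mul_diagonal_mul {A : Matrix n n ℂ} (hA : A.IsHermitian) :
    A = (hA.eigenvectorUnitary : Matrix n n ℂ) *
      diagonal (fun i => (hA.eigenvalues i : ℂ)) *
      (hA.eigenvectorUnitary : Matrix n n ℂ)ᴴ := by
  conv_lhs => rw [hA.spectral_theorem, Unitary.conjStarAlgAut_apply]
  rfl

theorem star_dotProduct_conj_diagonal_mulVec (U : Matrix n n ℂ) (d : n → ℝ) (x : n → ℂ) :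
    star x ⬝ᵥ ((U * diagonal (fun i => (d i : ℂ)) * Uᴴ) *ᵥ x) =
      ((∑ j, ‖(Uᴴ *ᵥ x) j‖ ^ 2 * d j : ℝ) : ℂ) := by
  rw [← mulVec_mulVec, ← mulVec_mulVec, dotProduct_mulVec, ← conjTranspose_conjTranspose U,
    ← star_mulVec, conjTranspose_conjTranspose]
  simp only [dotProduct, mulVec_diagonal, Pi.star_apply, Complex.ofReal_sum]
  refine Finset.sum_congr rfl fun j _ => ?_
  push_cast
  rw [← Complex.conj_mul', Complex.star_def]
  ring

/-- Scalar Jensen inequality for the quadratic forms of `f(A)` and `A`. -/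
theorem PosSemidef.re_cfc_le_of_concaveOn {A : Matrix n n ℂ} (hA : A.PosSemidef) {f : ℝ → ℝ}
    (hf : ConcaveOn ℝ (Set.Ici 0) f) {x : n → ℂ} (hx : ∑ j, ‖x j‖ ^ 2 = 1) :
    (star x ⬝ᵥ (cfc f A *ᵥ x)).re ≤ f (star x ⬝ᵥ (A *ᵥ x)).re := by
  have hU : ∑ j, ‖((hA.1.eigenvectorUnitary : Matrix n n ℂ)ᴴ *ᵥ x) j‖ ^ 2 = 1 := by
    rw [sum_norm_sq_mulVec_of_isometry, hx]
    rw [conjTranspose_conjTranspose]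
    exact Unitary.coe_mul_star_self hA.1.eigenvectorUnitary
  have h₁ : (star x ⬝ᵥ (A *ᵥ x)).re =
      ∑ j, ‖((hA.1.eigenvectorUnitary : Matrix n n ℂ)ᴴ *ᵥ x) j‖ ^ 2 * hA.1.eigenvalues j := by
    conv_lhs => rw [hA.1.eq_mul_diagonal_mul]
    rw [star_dotProduct_conj_diagonal_mulVec, Complex.ofReal_re]
  rw [hA.1.cfc_eq_mul_diagonal_mul,
    star_dotProduct_conj_diagonal_mulVec _ (fun i => f (hA.1.eigenvalues i)), Complex.ofReal_re, h₁]
  simpa only [smul_eq_mul] using hf.le_map_sum (fun i _ => sq_nonneg _) hU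
    (fun i _ => hA.eigenvalues_nonneg i)

/-- A comparison of quadratic forms through a monotone function gives, by the Courant-Fischer
principle, the same comparison of the ordered eigenvalues. -/
theorem IsHermitian.eigenvalues_le_of_re_le {P A : Matrix n n ℂ} (hP : P.IsHermitian)
    (hA : A.PosSemidef) {f : ℝ → ℝ} (hf : MonotoneOn f (Set.Ici 0))
    (h : ∀ x : n → ℂ, ∑ j, ‖x j‖ ^ 2 = 1 →
      (star x ⬝ᵥ (P *ᵥ x)).re ≤ f (star x ⬝ᵥ (A *ᵥ x)).re) (i : n) :
    hP.eigenvalues i ≤ f (hA.1.eigenvalues i) := by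
  set e : Fin (Fintype.card n) ≃ n := Fintype.equivOfCardEq (Fintype.card_fin _)
  set U : Matrix n n ℂ := (hA.1.eigenvectorUnitary : Matrix n n ℂ)
  set W : Matrix n n ℂ := (hP.eigenvectorUnitary : Matrix n n ℂ)
  have hUU : U * Uᴴ = 1 := Unitary.coe_mul_star_self hA.1.eigenvectorUnitary
  have hWW : W * Wᴴ = 1 := Unitary.coe_mul_star_self hP.eigenvectorUnitary
  -- a unit vector in the top eigenspaces of `P` and the bottom eigenspaces of `A`
  obtain ⟨x, hx1, hxU, hxW⟩ : ∃ x : n → ℂ, ∑ j, ‖x j‖ ^ 2 = 1 ∧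
      (∀ j, e.symm j < e.symm i → (Uᴴ *ᵥ x) j = 0) ∧
      (∀ j, e.symm i < e.symm j → (Wᴴ *ᵥ x) j = 0) := by
    let L : (n → ℂ) →ₗ[ℂ] ({j : n // e.symm j ≠ e.symm i} → ℂ) :=
      LinearMap.pi fun j => if e.symm j.1 < e.symm i
        then (LinearMap.proj j.1).comp (Matrix.toLin' Uᴴ)
        else (LinearMap.proj j.1).comp (Matrix.toLin' Wᴴ)
    have hL : LinearMap.ker L ≠ ⊥ := by
      apply LinearMap.ker_ne_bot_of_finrank_lt
      rw [Module.finrank_fintype_fun_eq_card, Module.finrank_fintype_fun_eq_card]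
      exact Fintype.card_subtype_lt (x := i) (by simp)
    obtain ⟨y, hy, hy0⟩ := Submodule.exists_mem_ne_zero_of_ne_bot hL
    have hyU : ∀ j, e.symm j < e.symm i → (Uᴴ *ᵥ y) j = 0 := fun j hj => by
      simpa [L, hj] using congrFun (LinearMap.mem_ker.1 hy) ⟨j, hj.ne⟩
    have hyW : ∀ j, e.symm i < e.symm j → (Wᴴ *ᵥ y) j = 0 := fun j hj => by
      simpa [L, hj.not_gt] using congrFun (LinearMap.mem_ker.1 hy) ⟨j, hj.ne'⟩
    have hpos : 0 < ∑ j, ‖y j‖ ^ 2 := by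
      obtain ⟨j, hj⟩ := Function.ne_iff.1 hy0
      exact Finset.sum_pos' (fun _ _ => sq_nonneg _)
        ⟨j, Finset.mem_univ _, pow_pos (norm_pos_iff.2 hj) 2⟩
    refine ⟨((Real.sqrt (∑ j, ‖y j‖ ^ 2))⁻¹ : ℂ) • y, ?_, fun j hj => ?_, fun j hj => ?_⟩
    · simp only [Pi.smul_apply, smul_eq_mul, norm_mul, mul_pow, ← Finset.mul_sum, norm_inv,
        Complex.norm_real, Real.norm_eq_abs, inv_pow, sq_abs, Real.sq_sqrt hpos.le]
      exact inv_mul_cancel₀ hpos.ne'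
    · rw [mulVec_smul, Pi.smul_apply, hyU j hj, smul_zero]
    · rw [mulVec_smul, Pi.smul_apply, hyW j hj, smul_zero]
  have hU1 : ∑ j, ‖(Uᴴ *ᵥ x) j‖ ^ 2 = 1 := by
    rw [sum_norm_sq_mulVec_of_isometry (by rwa [conjTranspose_conjTranspose]), hx1]
  have hW1 : ∑ j, ‖(Wᴴ *ᵥ x) j‖ ^ 2 = 1 := by
    rw [sum_norm_sq_mulVec_of_isometry (by rwa [conjTranspose_conjTranspose]), hx1]
  have hxA : (star x ⬝ᵥ (A *ᵥ x)).re = ∑ j, ‖(Uᴴ *ᵥ x) j‖ ^ 2 * hA.1.eigenvalues j := by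
    conv_lhs => rw [hA.1.eq_mul_diagonal_mul]
    rw [star_dotProduct_conj_diagonal_mulVec, Complex.ofReal_re]
  have hxP : (star x ⬝ᵥ (P *ᵥ x)).re = ∑ j, ‖(Wᴴ *ᵥ x) j‖ ^ 2 * hP.eigenvalues j := by
    conv_lhs => rw [hP.eq_mul_diagonal_mul]
    rw [star_dotProduct_conj_diagonal_mulVec, Complex.ofReal_re]
  have hA_le : (star x ⬝ᵥ (A *ᵥ x)).re ≤ hA.1.eigenvalues i := by
    rw [hxA, ← one_mul (hA.1.eigenvalues i), ← hU1, Finset.sum_mul]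
    refine Finset.sum_le_sum fun j _ => ?_
    rcases lt_or_ge (e.symm j) (e.symm i) with hj | hj
    · simp [hxU j hj]
    · exact mul_le_mul_of_nonneg_left (hA.1.eigenvalues₀_antitone hj) (sq_nonneg _)
  have hP_ge : hP.eigenvalues i ≤ (star x ⬝ᵥ (P *ᵥ x)).re := by
    rw [hxP, ← one_mul (hP.eigenvalues i), ← hW1, Finset.sum_mul]
    refine Finset.sum_le_sum fun j _ => ?_
    rcases lt_or_ge (e.symm i) (e.symm j) with hj | hj
    · simp [hxW j hj]
    · exact mul_le_mul_of_nonneg_left (hP.eigenvalues₀_antitone hj) (sq_nonneg _)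
  have hA0 : 0 ≤ (star x ⬝ᵥ (A *ᵥ x)).re := by
    rw [hxA]
    exact Finset.sum_nonneg fun j _ => mul_nonneg (sq_nonneg _) (hA.eigenvalues_nonneg j)
  exact hP_ge.trans ((h x hx1).trans (hf hA0 (hA.eigenvalues_nonneg i) hA_le))

end Matrix

theorem ConcaveOn.monotoneOn_of_nonneg {f : ℝ → ℝ} (hf : ConcaveOn ℝ (Set.Ici 0) f)
    (hf₀ : ∀ x ∈ Set.Ici (0 : ℝ), 0 ≤ f x) : MonotoneOn f (Set.Ici 0) := by
  intro x hx y hy hxy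
  by_contra! hlt
  have hxy' : x < y := hxy.lt_of_ne (by rintro rfl; exact lt_irrefl _ hlt)
  have hd : 0 < f x - f y := sub_pos.2 hlt
  have ht : 0 < (y - x) * (f y + 1) / (f x - f y) :=
    div_pos (mul_pos (sub_pos.2 hxy') (by linarith [hf₀ y hy])) hd
  set t := (y - x) * (f y + 1) / (f x - f y) with ht_def
  have hz : y + t ∈ Set.Ici (0 : ℝ) := add_nonneg hy ht.le
  have hs := hf.slope_anti_adjacent hx hz hxy' (lt_add_of_pos_right y ht)
  rw [add_sub_cancel_left, div_le_div_iff₀ ht (sub_pos.2 hxy')] at hs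
  have hmul : t * (f x - f y) = (y - x) * (f y + 1) := div_mul_cancel₀ _ hd.ne'
  have hneg : (f (y + t) + 1) * (y - x) ≤ 0 := by linarith
  nlinarith [mul_pos (sub_pos.2 hxy') (by linarith [hf₀ _ hz] : 0 < f (y + t) + 1)]

namespace IsSymmetricNorm

open Matrix

variable {k n : Type*} [Fintype k] [DecidableEq k] [Fintype n] [DecidableEq n]

theorem diagonal_mono {N : Matrix n n ℂ → ℝ} (hN : IsSymmetricNorm N) {p q : n → ℝ}
    (hp : ∀ i, 0 ≤ p i) (hpq : ∀ i, p i ≤ q i) :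
    N (diagonal fun i => (p i : ℂ)) ≤ N (diagonal fun i => (q i : ℂ)) := by
  obtain ⟨hadd, hsmul, -, hinv⟩ := hN
  -- write `p i = q i * cos (θ i)` and average the two unitaries `diagonal (exp (± θ i * I))`
  have hcos : ∀ i, ∃ θ : ℝ, q i * Real.cos θ = p i := fun i => by
    refine ⟨Real.arccos (p i / q i), ?_⟩
    rw [Real.cos_arccos]
    · rcases (hp i).trans (hpq i) |>.eq_or_lt with h | h
      · rw [← h, zero_mul]
        linarith [hp i, hpq i]
      · exact mul_div_cancel₀ _ h.ne'
    · linarith [div_nonneg (hp i) ((hp i).trans (hpq i))]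
    · exact div_le_one_of_le₀ (hpq i) ((hp i).trans (hpq i))
  choose θ hθ using hcos
  have hunit : ∀ φ : n → ℝ,
      (diagonal fun i => Complex.exp (φ i * Complex.I)) ∈ unitaryGroup n ℂ := fun φ => by
    rw [mem_unitaryGroup_iff, star_eq_conjTranspose, diagonal_conjTranspose, diagonal_mul_diagonal,
      ← diagonal_one]
    congr 1
    funext i
    simp [Complex.mul_conj', Complex.norm_exp_ofReal_mul_I]
  have hrot : ∀ φ : n → ℝ, N ((diagonal fun i => Complex.exp (φ i * Complex.I)) *
      diagonal fun i => (q i : ℂ)) = N (diagonal fun i => (q i : ℂ)) := fun φ => by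
    simpa using hinv (diagonal fun i => (q i : ℂ)) _ 1 (hunit φ) (one_mem _)
  have hdecomp : (diagonal fun i => (p i : ℂ)) = (1 / 2 : ℂ) •
      ((diagonal fun i => Complex.exp ((θ i : ℝ) * Complex.I)) * (diagonal fun i => (q i : ℂ)) +
      (diagonal fun i => Complex.exp ((-θ i : ℝ) * Complex.I)) * diagonal fun i => (q i : ℂ)) := by
    rw [diagonal_mul_diagonal, diagonal_mul_diagonal, diagonal_add, ← diagonal_smul]
    congr 1
    funext i
    simp only [Pi.smul_apply, smul_eq_mul]
    rw [← hθ i, ← add_mul, Complex.ofReal_mul, Complex.ofReal_cos, Complex.cos]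
    push_cast
    ring
  have hle := hadd
    ((diagonal fun i => Complex.exp ((θ i : ℝ) * Complex.I)) * diagonal fun i => (q i : ℂ))
    ((diagonal fun i => Complex.exp ((-θ i : ℝ) * Complex.I)) * diagonal fun i => (q i : ℂ))
  rw [hrot θ, hrot fun i => -θ i] at hle
  rw [hdecomp, hsmul, show ‖(1 / 2 : ℂ)‖ = 1 / 2 by norm_num]
  linarith

theorem conj_unitary {N : Matrix n n ℂ → ℝ} (hN : IsSymmetricNorm N) (U : unitaryGroup n ℂ)
    (D : Matrix n n ℂ) : N ((U : Matrix n n ℂ) * D * (U : Matrix n n ℂ)ᴴ) = N D :=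
  hN.2.2.2 D _ _ U.2 (star U).2

theorem conjTranspose_mul_self_eq {N : Matrix n n ℂ → ℝ} (hN : IsSymmetricNorm N)
    (M : Matrix n n ℂ) : N (Mᴴ * M) = N (M * Mᴴ) := by
  have h₁ := isHermitian_conjTranspose_mul_self M
  have h₂ := isHermitian_mul_conjTranspose_self M
  have h : h₁.eigenvalues = h₂.eigenvalues :=
    (IsHermitian.eigenvalues_eq_eigenvalues_iff h₁ h₂).2 (charpoly_mul_comm _ _)
  conv_lhs => rw [h₁.eq_mul_diagonal_mul]
  conv_rhs => rw [h₂.eq_mul_diagonal_mul]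
  rw [hN.conj_unitary, hN.conj_unitary, h]

/-- Padding by an isometry `J` turns a symmetric norm into a symmetric norm. -/
theorem comp_isometry {N : Matrix k k ℂ → ℝ} (hN : IsSymmetricNorm N) {J : Matrix k n ℂ}
    (hJ : Jᴴ * J = 1) : IsSymmetricNorm fun M : Matrix n n ℂ => N (J * M * Jᴴ) := by
  have hJ' : ∀ M : Matrix n k ℂ, Jᴴ * (J * M) = M := fun M => by
    rw [← Matrix.mul_assoc, hJ, Matrix.one_mul]
  have hunit : ∀ U ∈ unitaryGroup n ℂ, J * U * Jᴴ + (1 - J * Jᴴ) ∈ unitaryGroup k ℂ := by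
    intro U hU
    rw [mem_unitaryGroup_iff, star_eq_conjTranspose] at hU ⊢
    have hU' : ∀ M : Matrix n k ℂ, U * (Uᴴ * M) = M := fun M => by
      rw [← Matrix.mul_assoc, hU, Matrix.one_mul]
    simp only [conjTranspose_add, conjTranspose_sub, conjTranspose_mul, conjTranspose_one,
      conjTranspose_conjTranspose, Matrix.add_mul, Matrix.mul_add, Matrix.sub_mul, Matrix.mul_sub,
      Matrix.mul_assoc, Matrix.one_mul, Matrix.mul_one, hJ', hU']
    abel
  refine ⟨fun A B => ?_, fun c A => ?_, fun A h => ?_, fun A U V hU hV => ?_⟩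
  · simpa only [Matrix.mul_add, Matrix.add_mul] using hN.1 (J * A * Jᴴ) (J * B * Jᴴ)
  · simpa only [Matrix.mul_smul, Matrix.smul_mul] using hN.2.1 c (J * A * Jᴴ)
  · have h0 := hN.2.2.1 _ h
    calc A = Jᴴ * (J * A * Jᴴ) * J := by
          rw [Matrix.mul_assoc J, hJ', Matrix.mul_assoc, hJ, Matrix.mul_one]
      _ = 0 := by rw [h0, Matrix.mul_zero, Matrix.zero_mul]
  · beta_reduce
    rw [← hN.2.2.2 (J * A * Jᴴ) _ _ (hunit U hU) (hunit V hV)]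
    congr 1
    simp only [Matrix.add_mul, Matrix.mul_add, Matrix.sub_mul, Matrix.mul_sub,
      Matrix.mul_assoc, Matrix.one_mul, Matrix.mul_one, hJ']
    abel

theorem le_cfc_of_eigenvalues_le {N : Matrix n n ℂ → ℝ} (hN : IsSymmetricNorm N)
    {P A : Matrix n n ℂ} (hP : P.PosSemidef) (hA : A.IsHermitian) {f : ℝ → ℝ}
    (h : ∀ i, hP.1.eigenvalues i ≤ f (hA.eigenvalues i)) : N P ≤ N (cfc f A) := by
  conv_lhs => rw [hP.1.eq_mul_diagonal_mul]
  rw [hA.cfc_eq_mul_diagonal_mul, hN.conj_unitary, hN.conj_unitary]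
  exact hN.diagonal_mono hP.eigenvalues_nonneg h

/-- For a nonnegative concave `f`, the compression of `f(H)` is dominated by `f` of the
compression of `H`. -/
theorem compression_cfc_le {N : Matrix n n ℂ → ℝ} (hN : IsSymmetricNorm N) {f : ℝ → ℝ}
    (hf₀ : ∀ x ∈ Set.Ici (0 : ℝ), 0 ≤ f x) (hf : ConcaveOn ℝ (Set.Ici 0) f)
    {H : Matrix k k ℂ} (hH : H.PosSemidef) (hF : (cfc f H).PosSemidef)
    {J : Matrix k n ℂ} (hJ : Jᴴ * J = 1) :
    N (Jᴴ * cfc f H * J) ≤ N (cfc f (Jᴴ * H * J)) := by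
  have hP := hF.conjTranspose_mul_mul_same J
  have hA := hH.conjTranspose_mul_mul_same J
  refine hN.le_cfc_of_eigenvalues_le hP hA.1
    (hP.1.eigenvalues_le_of_re_le hA (hf.monotoneOn_of_nonneg hf₀) fun x hx => ?_)
  have hform : ∀ M : Matrix k k ℂ,
      star x ⬝ᵥ ((Jᴴ * M * J) *ᵥ x) = star (J *ᵥ x) ⬝ᵥ (M *ᵥ (J *ᵥ x)) := fun M => by
    rw [star_mulVec, ← dotProduct_mulVec, mulVec_mulVec, mulVec_mulVec, Matrix.mul_assoc]
  rw [hform, hform]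
  exact hH.re_cfc_le_of_concaveOn hf ((sum_norm_sq_mulVec_of_isometry hJ x).trans hx)

theorem root_mul_isometry_mul_root_le {N : Matrix k k ℂ → ℝ} (hN : IsSymmetricNorm N) {f : ℝ → ℝ}
    (hf₀ : ∀ x ∈ Set.Ici (0 : ℝ), 0 ≤ f x) (hf : ConcaveOn ℝ (Set.Ici 0) f)
    {H R : Matrix k k ℂ} (hH : H.PosSemidef) (hR : R.IsHermitian) (hRR : R * R = cfc f H)
    {J : Matrix k n ℂ} (hJ : Jᴴ * J = 1) :
    N (R * (J * Jᴴ) * R) ≤ N (J * cfc f (Jᴴ * H * J) * Jᴴ) := by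
  have hF : (cfc f H).PosSemidef := by
    simpa only [hR.eq, hRR] using posSemidef_conjTranspose_mul_self R
  have hJ' : ∀ M : Matrix n k ℂ, Jᴴ * (J * M) = M := fun M => by
    rw [← Matrix.mul_assoc, hJ, Matrix.one_mul]
  have h₁ : R * (J * Jᴴ) * R = (J * Jᴴ * R)ᴴ * (J * Jᴴ * R) := by
    simp only [conjTranspose_mul, conjTranspose_conjTranspose, hR.eq, Matrix.mul_assoc, hJ']
  have h₂ : (J * Jᴴ * R) * (J * Jᴴ * R)ᴴ = J * (Jᴴ * cfc f H * J) * Jᴴ := by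
    simp only [conjTranspose_mul, conjTranspose_conjTranspose, hR.eq, Matrix.mul_assoc, ← hRR]
  rw [h₁, hN.conjTranspose_mul_self_eq, h₂]
  exact (hN.comp_isometry hJ).compression_cfc_le hf₀ hf hH hF hJ

theorem cfc_le_add_of_isometries {l : Type*} [Fintype l] [DecidableEq l]
    {N : Matrix k k ℂ → ℝ} (hN : IsSymmetricNorm N) {f : ℝ → ℝ}
    (hf₀ : ∀ x ∈ Set.Ici (0 : ℝ), 0 ≤ f x) (hf : ConcaveOn ℝ (Set.Ici 0) f)
    {H : Matrix k k ℂ} (hH : H.PosSemidef) {J : Matrix k n ℂ} {K : Matrix k l ℂ}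
    (hJ : Jᴴ * J = 1) (hK : Kᴴ * K = 1) (hJK : J * Jᴴ + K * Kᴴ = 1) :
    N (cfc f H) ≤ N (J * cfc f (Jᴴ * H * J) * Jᴴ) + N (K * cfc f (Kᴴ * H * K) * Kᴴ) := by
  obtain ⟨R, hR, hRR⟩ : ∃ R : Matrix k k ℂ, R.IsHermitian ∧ R * R = cfc f H := by
    have hcont : ∀ g : ℝ → ℝ, ContinuousOn g (spectrum ℝ H) := fun g =>
      (finite_real_spectrum (A := H)).continuousOn g
    refine ⟨cfc (fun x => Real.sqrt (f x)) H, cfc_predicate (p := IsSelfAdjoint) _ H, ?_⟩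
    rw [← cfc_mul _ _ H (hcont _) (hcont _)]
    refine cfc_congr fun x hx => Real.mul_self_sqrt (hf₀ x ?_)
    rw [hH.1.spectrum_real_eq_range_eigenvalues] at hx
    obtain ⟨i, rfl⟩ := hx
    exact hH.eigenvalues_nonneg i
  calc N (cfc f H) = N (R * (J * Jᴴ) * R + R * (K * Kᴴ) * R) := by
        rw [← Matrix.add_mul, ← Matrix.mul_add, hJK, Matrix.mul_one, hRR]
    _ ≤ _ := (hN.1 _ _).trans (add_le_add
        (hN.root_mul_isometry_mul_root_le hf₀ hf hH hR hRR hJ)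
        (hN.root_mul_isometry_mul_root_le hf₀ hf hH hR hRR hK))

end IsSymmetricNorm

/-- For a nonnegative concave `f` on `[0,∞)` and a positive semidefinite
block matrix `H = [[A,X],[X*,B]]`, every symmetric norm satisfies
`‖f(H)‖ ≤ ‖f(A) ⊕ 0‖ + ‖f(B) ⊕ 0‖`. -/
theorem symmetric_norm_concave_block {n m : ℕ} (f : ℝ → ℝ)
    (hf_nonneg : ∀ x ∈ Set.Ici (0:ℝ), 0 ≤ f x)
    (hf_concave : ConcaveOn ℝ (Set.Ici 0) f)
    (A : Matrix (Fin n) (Fin n) ℂ) (B : Matrix (Fin m) (Fin m) ℂ)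
    (X : Matrix (Fin n) (Fin m) ℂ)
    (hH : (Matrix.fromBlocks A X Xᴴ B).PosSemidef)
    (N : Matrix (Fin n ⊕ Fin m) (Fin n ⊕ Fin m) ℂ → ℝ)
    (hN : IsSymmetricNorm N) :
    N (cfc f (Matrix.fromBlocks A X Xᴴ B)) ≤
      N (Matrix.fromBlocks (cfc f A) 0 0 0) + N (Matrix.fromBlocks 0 0 0 (cfc f B)) := by
  have h := hN.cfc_le_add_of_isometries hf_nonneg hf_concave hH
    (J := Matrix.fromRows (1 : Matrix (Fin n) (Fin n) ℂ) 0)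
    (K := Matrix.fromRows 0 (1 : Matrix (Fin m) (Fin m) ℂ))
    (by simp [Matrix.conjTranspose_fromRows_eq_fromCols_conjTranspose,
      Matrix.fromCols_mul_fromRows])
    (by simp [Matrix.conjTranspose_fromRows_eq_fromCols_conjTranspose,
      Matrix.fromCols_mul_fromRows])
    (by simp [Matrix.conjTranspose_fromRows_eq_fromCols_conjTranspose, -Matrix.mul_fromCols,
      -Matrix.fromRows_mul, Matrix.fromRows_mul_fromCols, Matrix.fromBlocks_add])
  rw [Matrix.fromRows_one_zero_conj, Matrix.fromRows_zero_one_conj] at h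
  simpa [Matrix.conjTranspose_fromRows_eq_fromCols_conjTranspose, Matrix.fromCols_mul_fromBlocks,
    Matrix.fromCols_mul_fromRows] using h
end

section
/- Let g : [0,∞) → [0,∞) be a convex function with g(0) = 0 and let A, B be n×n positive semidefinite complex matrices. Then there exist unitary matrices U, V ∈ M_n(ℂ) such that g(A+B) ≥ U g(A) U* + V g(B) V* in the Loewner order. -/
open scoped Matrix ComplexOrder

namespace Matrix

variable {m : Type*} [Fintype m] [DecidableEq m]

lemma sum_norm_sq_star_unitary_mulVec (U : unitaryGroup m ℂ) (x : m → ℂ) :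
    ∑ i, ‖(star (U : Matrix m m ℂ) *ᵥ x) i‖ ^ 2 = ∑ i, ‖x i‖ ^ 2 := by
  have key (y : m → ℂ) : ((∑ i, ‖y i‖ ^ 2 : ℝ) : ℂ) = star y ⬝ᵥ y := by
    simp [dotProduct, Complex.conj_mul']
  have h : star (star (U : Matrix m m ℂ) *ᵥ x) ⬝ᵥ (star (U : Matrix m m ℂ) *ᵥ x)
      = star x ⬝ᵥ x := by
    rw [star_mulVec, ← dotProduct_mulVec, mulVec_mulVec, star_eq_conjTranspose,
      conjTranspose_conjTranspose, ← star_eq_conjTranspose, Unitary.mul_star_self_of_mem U.2, one_mulVec]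
  rw [← key, ← key] at h
  exact_mod_cast h

namespace IsHermitian

variable {A M : Matrix m m ℂ}

lemma cfc_eq_mul_diagonal_mul_s2 (hA : A.IsHermitian) (f : ℝ → ℝ) :
    cfc f A = (hA.eigenvectorUnitary : Matrix m m ℂ)
      * diagonal (fun i ↦ ((f (hA.eigenvalues i) : ℝ) : ℂ))
      * (hA.eigenvectorUnitary : Matrix m m ℂ)ᴴ := by
  rw [hA.cfc_eq, IsHermitian.cfc, Unitary.conjStarAlgAut_apply]
  rfl

lemma star_dotProduct_cfc_mulVec (hA : A.IsHermitian) (f : ℝ → ℝ) (x : m → ℂ) :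
    star x ⬝ᵥ (cfc f A *ᵥ x) = ((∑ i, f (hA.eigenvalues i)
      * ‖(star (hA.eigenvectorUnitary : Matrix m m ℂ) *ᵥ x) i‖ ^ 2 : ℝ) : ℂ) := by
  rw [hA.cfc_eq_mul_diagonal_mul_s2, ← mulVec_mulVec, ← mulVec_mulVec, dotProduct_mulVec,
    ← star_eq_conjTranspose]
  have h : star x ᵥ* (hA.eigenvectorUnitary : Matrix m m ℂ)
      = star (star (hA.eigenvectorUnitary : Matrix m m ℂ) *ᵥ x) := by
    rw [star_mulVec, star_eq_conjTranspose, conjTranspose_conjTranspose]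
  rw [h]
  simp only [dotProduct, mulVec_diagonal, Pi.star_apply, RCLike.star_def, Complex.ofReal_sum,
    Complex.ofReal_mul, Complex.ofReal_pow]
  refine Finset.sum_congr rfl fun i _ ↦ ?_
  rw [← Complex.conj_mul']
  ring

lemma star_dotProduct_mulVec (hA : A.IsHermitian) (x : m → ℂ) :
    star x ⬝ᵥ (A *ᵥ x) = ((∑ i, hA.eigenvalues i
      * ‖(star (hA.eigenvectorUnitary : Matrix m m ℂ) *ᵥ x) i‖ ^ 2 : ℝ) : ℂ) := by
  have h := hA.star_dotProduct_cfc_mulVec id x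
  rwa [cfc_id ℝ A hA.isSelfAdjoint] at h

/-- A vector in the span of the top eigenvectors of `A` up to index `j` and in the span of the
bottom eigenvectors of `M` from index `j` on. -/
lemma exists_intermediate_vector (hA : A.IsHermitian) (hM : M.IsHermitian) (j : m) :
    ∃ x : m → ℂ, ∑ i, ‖x i‖ ^ 2 = 1 ∧
      hA.eigenvalues j ≤ (star x ⬝ᵥ (A *ᵥ x)).re ∧
      (star x ⬝ᵥ (M *ᵥ x)).re ≤ hM.eigenvalues j := by
  set e : m ≃ Fin (Fintype.card m) := (Fintype.equivOfCardEq (Fintype.card_fin _)).symm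
  set U := star (hA.eigenvectorUnitary : Matrix m m ℂ) with hU
  set W := star (hM.eigenvectorUnitary : Matrix m m ℂ) with hW
  let N : Matrix m m ℂ := fun i ↦ if e j < e i then U i else if e i < e j then W i else 0
  have hN : N.det = 0 := det_eq_zero_of_row_eq_zero j (by simp [N])
  obtain ⟨y, hy0, hy⟩ := exists_mulVec_eq_zero_iff.mpr hN
  have hpos : 0 < ∑ i, ‖y i‖ ^ 2 := by
    obtain ⟨i, hi⟩ := Function.ne_iff.mp hy0
    refine Finset.sum_pos' (fun _ _ ↦ by positivity) ⟨i, Finset.mem_univ _, ?_⟩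
    have : 0 < ‖y i‖ := norm_pos_iff.mpr hi
    positivity
  set r : ℝ := (√(∑ i, ‖y i‖ ^ 2))⁻¹ with hr
  have hx1 : ∑ i, ‖((r : ℂ) • y) i‖ ^ 2 = 1 := by
    simp only [Pi.smul_apply, smul_eq_mul, norm_mul, mul_pow, Complex.norm_real, Real.norm_eq_abs,
      sq_abs, ← Finset.mul_sum, hr, inv_pow, Real.sq_sqrt hpos.le]
    exact inv_mul_cancel₀ hpos.ne'
  have hx : N *ᵥ ((r : ℂ) • y) = 0 := by rw [mulVec_smul, hy, smul_zero]
  generalize (r : ℂ) • y = x at hx hx1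
  have hUx (i : m) (hi : e j < e i) : (U *ᵥ x) i = 0 := by
    have := congrFun hx i
    simpa [mulVec, N, hi] using this
  have hWx (i : m) (hi : e i < e j) : (W *ᵥ x) i = 0 := by
    have := congrFun hx i
    simpa [mulVec, N, hi, hi.not_gt] using this
  refine ⟨x, hx1, ?_, ?_⟩
  · rw [hA.star_dotProduct_mulVec, Complex.ofReal_re]
    calc hA.eigenvalues j
        = ∑ i, hA.eigenvalues j * ‖(U *ᵥ x) i‖ ^ 2 := by
          rw [← Finset.mul_sum, hU, sum_norm_sq_star_unitary_mulVec, hx1, mul_one]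
      _ ≤ _ := by
          refine Finset.sum_le_sum fun i _ ↦ ?_
          rcases lt_or_ge (e j) (e i) with h | h
          · simp [← hU, hUx i h]
          · exact mul_le_mul_of_nonneg_right (hA.eigenvalues₀_antitone h) (by positivity)
  · rw [hM.star_dotProduct_mulVec, Complex.ofReal_re]
    calc _ ≤ ∑ i, hM.eigenvalues j * ‖(W *ᵥ x) i‖ ^ 2 := by
          refine Finset.sum_le_sum fun i _ ↦ ?_
          rcases lt_or_ge (e i) (e j) with h | h
          · simp [← hW, hWx i h]
          · exact mul_le_mul_of_nonneg_right (hM.eigenvalues₀_antitone h) (by positivity)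
      _ = hM.eigenvalues j := by
          rw [← Finset.mul_sum, hW, sum_norm_sq_star_unitary_mulVec, hx1, mul_one]

lemma exists_unitary_posSemidef_sub (hA : A.IsHermitian) (hM : M.IsHermitian) (g : ℝ → ℝ)
    (h : ∀ i, g (hA.eigenvalues i) ≤ hM.eigenvalues i) :
    ∃ U ∈ unitaryGroup m ℂ, (M - U * cfc g A * Uᴴ).PosSemidef := by
  refine ⟨hM.eigenvectorUnitary * star hA.eigenvectorUnitary,
    (hM.eigenvectorUnitary * star hA.eigenvectorUnitary).2, ?_⟩
  set P := (hA.eigenvectorUnitary : Matrix m m ℂ) with hP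
  set Q := (hM.eigenvectorUnitary : Matrix m m ℂ)
  have hPP : Pᴴ * P = 1 := Unitary.coe_star_mul_self hA.eigenvectorUnitary
  have hM' : M = Q * diagonal (fun i ↦ ((hM.eigenvalues i : ℝ) : ℂ)) * Qᴴ := by
    have := hM.cfc_eq_mul_diagonal_mul_s2 id
    rwa [cfc_id ℝ M hM.isSelfAdjoint] at this
  have hconj : Q * star P * cfc g A * (Q * star P)ᴴ
      = Q * diagonal (fun i ↦ ((g (hA.eigenvalues i) : ℝ) : ℂ)) * Qᴴ := by
    rw [hA.cfc_eq_mul_diagonal_mul_s2, ← hP, conjTranspose_mul, star_eq_conjTranspose,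
      conjTranspose_conjTranspose]
    calc _ = Q * (Pᴴ * P) * diagonal (fun i ↦ ((g (hA.eigenvalues i) : ℝ) : ℂ))
          * (Pᴴ * P) * Qᴴ := by simp only [Matrix.mul_assoc]
      _ = _ := by simp only [hPP, Matrix.mul_one]
  change (M - Q * star P * cfc g A * (Q * star P)ᴴ).PosSemidef
  rw [hconj]
  nth_rw 1 [hM']
  rw [← Matrix.sub_mul, ← Matrix.mul_sub, diagonal_sub]
  refine PosSemidef.mul_mul_conjTranspose_same (PosSemidef.diagonal fun i ↦ ?_) Q
  have := h i
  simp only [Pi.zero_apply, ← Complex.ofReal_sub]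
  exact_mod_cast sub_nonneg.mpr this

end IsHermitian

lemma cfc_mul_cfc (A : Matrix m m ℂ) (f g : ℝ → ℝ) :
    cfc f A * cfc g A = cfc (fun x ↦ f x * g x) A :=
  (cfc_mul f g A (A.finite_real_spectrum.continuousOn _)
    (A.finite_real_spectrum.continuousOn _)).symm

lemma isHermitian_cfc (f : ℝ → ℝ) (A : Matrix m m ℂ) : (cfc f A).IsHermitian :=
  (cfc_predicate f A : IsSelfAdjoint _)

lemma PosSemidef.cfc_congr {A : Matrix m m ℂ} (hA : A.PosSemidef) {f g : ℝ → ℝ}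
    (h : ∀ x, 0 ≤ x → f x = g x) : cfc f A = cfc g A := by
  refine _root_.cfc_congr fun x hx ↦ h x ?_
  rw [hA.1.spectrum_real_eq_range_eigenvalues] at hx
  obtain ⟨i, rfl⟩ := hx
  exact hA.eigenvalues_nonneg i

lemma PosSemidef.cfc_sqrt_mul_self {A : Matrix m m ℂ} (hA : A.PosSemidef) {f : ℝ → ℝ}
    (hf : ∀ x, 0 ≤ x → 0 ≤ f x) :
    cfc (fun x ↦ √(f x)) A * cfc (fun x ↦ √(f x)) A = cfc f A := by
  rw [cfc_mul_cfc]
  exact hA.cfc_congr fun x hx ↦ Real.mul_self_sqrt (hf x hx)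

lemma posSemidef_one_sub_mul_conjTranspose {C : Matrix m m ℂ} (hC : (1 - Cᴴ * C).PosSemidef) :
    (1 - C * Cᴴ).PosSemidef := by
  have h1 := posSemidef_self_mul_conjTranspose (1 - C * Cᴴ)
  have h2 := hC.mul_mul_conjTranspose_same C
  convert h1.add h2 using 1
  simp only [conjTranspose_sub, conjTranspose_one, conjTranspose_mul, conjTranspose_conjTranspose]
  noncomm_ring

/-- Jensen's inequality for vectors of norm at most one. -/
lemma PosSemidef.map_star_dotProduct_mulVec_le {S : Matrix m m ℂ} (hS : S.PosSemidef)
    {g : ℝ → ℝ} (hg : ConvexOn ℝ (Set.Ici 0) g) (hg0 : g 0 = 0) {x : m → ℂ}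
    (hx : ∑ i, ‖x i‖ ^ 2 ≤ 1) :
    g (star x ⬝ᵥ (S *ᵥ x)).re ≤ (star x ⬝ᵥ (cfc g S *ᵥ x)).re := by
  rw [hS.1.star_dotProduct_mulVec, hS.1.star_dotProduct_cfc_mulVec, Complex.ofReal_re,
    Complex.ofReal_re]
  have hs := sum_norm_sq_star_unitary_mulVec hS.1.eigenvectorUnitary x
  have := hg.map_add_sum_le (t := Finset.univ) (v := 1 - ∑ i, ‖x i‖ ^ 2) (q := 0)
    (w := fun i ↦ ‖(star (hS.1.eigenvectorUnitary : Matrix m m ℂ) *ᵥ x) i‖ ^ 2)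
    (p := hS.1.eigenvalues) (fun _ _ ↦ by positivity) (by rw [hs]; ring)
    (fun i _ ↦ hS.eigenvalues_nonneg i) (by linarith) (Set.mem_Ici.mpr le_rfl)
  simpa [hg0, mul_comm] using this

lemma PosSemidef.exists_unitary_posSemidef_sub_contraction {S C : Matrix m m ℂ}
    (hS : S.PosSemidef) {g : ℝ → ℝ} (hg_nonneg : ∀ x, 0 ≤ x → 0 ≤ g x)
    (hg : ConvexOn ℝ (Set.Ici 0) g) (hg0 : g 0 = 0) (hC : (1 - Cᴴ * C).PosSemidef) :
    ∃ U ∈ unitaryGroup m ℂ, (cfc (fun x ↦ √(g x)) S * (Cᴴ * C) * cfc (fun x ↦ √(g x)) S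
      - U * cfc g (C * S * Cᴴ) * Uᴴ).PosSemidef := by
  set R := cfc (fun x ↦ √(g x)) S with hR
  have hRH : Rᴴ = R := isHermitian_cfc _ S
  have hRR : R * R = cfc g S := hS.cfc_sqrt_mul_self hg_nonneg
  have hA : (C * S * Cᴴ).PosSemidef := hS.mul_mul_conjTranspose_same C
  have hM : ((C * R) * (C * R)ᴴ).IsHermitian := isHermitian_mul_conjTranspose_self _
  have hM' : ((C * R)ᴴ * (C * R)).IsHermitian := isHermitian_conjTranspose_mul_self _
  have hMg : (C * R) * (C * R)ᴴ = C * cfc g S * Cᴴ := by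
    rw [conjTranspose_mul, hRH, ← hRR]
    simp only [Matrix.mul_assoc]
  have heq : R * (Cᴴ * C) * R = (C * R)ᴴ * (C * R) := by
    rw [conjTranspose_mul, hRH]
    simp only [Matrix.mul_assoc]
  have heig : hM'.eigenvalues = hM.eigenvalues :=
    (hM'.eigenvalues_eq_eigenvalues_iff hM).mpr (charpoly_mul_comm _ _)
  have hmono : ∀ a b, 0 ≤ a → a ≤ b → g a ≤ g b := by
    intro a b ha hab
    rcases ha.eq_or_lt with rfl | ha'
    · rw [hg0]; exact hg_nonneg _ hab
    · have hb : 0 < b := ha'.trans_le hab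
      have h := hg.2 (Set.mem_Ici.mpr le_rfl) (Set.mem_Ici.mpr hb.le)
        (sub_nonneg.mpr ((div_le_one hb).mpr hab)) (div_nonneg ha hb.le) (by ring)
      simp only [smul_eq_mul, mul_zero, hg0, zero_add, div_mul_cancel₀ _ hb.ne'] at h
      exact h.trans (mul_le_of_le_one_left (hg_nonneg _ hb.le) ((div_le_one hb).mpr hab))
  rw [heq]
  refine hA.1.exists_unitary_posSemidef_sub hM' g fun j ↦ ?_
  rw [heig]
  obtain ⟨x, hx1, hxA, hxM⟩ := hA.1.exists_intermediate_vector hM j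
  have hconj (X : Matrix m m ℂ) :
      star x ⬝ᵥ ((C * X * Cᴴ) *ᵥ x) = star (Cᴴ *ᵥ x) ⬝ᵥ (X *ᵥ (Cᴴ *ᵥ x)) := by
    rw [star_mulVec, conjTranspose_conjTranspose, ← mulVec_mulVec, ← mulVec_mulVec,
      dotProduct_mulVec]
  have key (y : m → ℂ) : star y ⬝ᵥ y = ((∑ i, ‖y i‖ ^ 2 : ℝ) : ℂ) := by
    simp [dotProduct, Complex.conj_mul']
  have hnorm : ∑ i, ‖(Cᴴ *ᵥ x) i‖ ^ 2 ≤ 1 := by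
    have h := (posSemidef_one_sub_mul_conjTranspose hC).re_dotProduct_nonneg x
    have h2 := hconj 1
    rw [Matrix.mul_one, one_mulVec, key] at h2
    rw [sub_mulVec, dotProduct_sub, one_mulVec, h2, key, hx1, ← Complex.ofReal_sub] at h
    exact sub_nonneg.mp h
  have hMx : star x ⬝ᵥ (((C * R) * (C * R)ᴴ) *ᵥ x) = star (Cᴴ *ᵥ x) ⬝ᵥ (cfc g S *ᵥ (Cᴴ *ᵥ x)) := by
    rw [hMg, hconj]
  rw [hMx] at hxM
  rw [hconj] at hxA
  exact (hmono _ _ (hA.eigenvalues_nonneg j) hxA).trans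
    ((hS.map_star_dotProduct_mulVec_le hg hg0 hnorm).trans hxM)

/-- Simultaneous factorization of two positive semidefinite matrices through their sum. -/
lemma PosSemidef.exists_contractions {A B : Matrix m m ℂ} (hA : A.PosSemidef)
    (hB : B.PosSemidef) :
    ∃ C D : Matrix m m ℂ, C * (A + B) * Cᴴ = A ∧ D * (A + B) * Dᴴ = B ∧
      (1 - (Cᴴ * C + Dᴴ * D)).PosSemidef := by
  have hS := hA.add hB
  obtain ⟨S, hSdef⟩ : ∃ S, S = A + B := ⟨_, rfl⟩
  rw [← hSdef] at hS ⊢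
  have hSid : cfc (fun x ↦ x) S = S := cfc_id' ℝ S hS.1.isSelfAdjoint
  set T := cfc (fun x ↦ (√x)⁻¹) S with hT
  set F := cfc (fun x : ℝ ↦ if x = 0 then (1 : ℝ) else 0) S with hF
  have hTH : Tᴴ = T := isHermitian_cfc _ S
  have hFH : Fᴴ = F := isHermitian_cfc _ S
  have hTST : T * S * T = 1 - F := by
    nth_rw 1 [← hSid]
    rw [eq_sub_iff_add_eq, ← cfc_const_one ℝ S hS.1.isSelfAdjoint, hT, hF, cfc_mul_cfc, cfc_mul_cfc,
      ← cfc_add S _ _ (S.finite_real_spectrum.continuousOn _)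
        (S.finite_real_spectrum.continuousOn _)]
    refine hS.cfc_congr fun x hx ↦ ?_
    rcases hx.eq_or_lt with rfl | hx
    · simp
    · have h := Real.sqrt_pos.mpr hx
      simp only [hx.ne', if_false, add_zero]
      nth_rw 2 [← Real.mul_self_sqrt hx.le]
      field_simp
  have hFF : F * F = F := by
    rw [hF, cfc_mul_cfc]
    exact hS.cfc_congr fun x _ ↦ by simp
  have hFpos : F.PosSemidef := by
    have := posSemidef_self_mul_conjTranspose F
    rwa [hFH, hFF] at this
  have hFSF : F * S * F = 0 := by
    nth_rw 1 [← hSid]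
    rw [hF, cfc_mul_cfc, cfc_mul_cfc, ← cfc_const_zero ℝ S]
    exact hS.cfc_congr fun x _ ↦ by aesop
  have factor {X Y : Matrix m m ℂ} (hX : X.PosSemidef) (hY : Y.PosSemidef) (hXY : S = X + Y) :
      ∃ C, C * S * Cᴴ = X ∧ Cᴴ * C = T * X * T := by
    set a := cfc (fun x ↦ √x) X
    have haH : aᴴ = a := isHermitian_cfc _ X
    have haa : a * a = X :=
      (hX.cfc_sqrt_mul_self (f := fun x ↦ x) fun _ h ↦ h).trans (cfc_id' ℝ X hX.1.isSelfAdjoint)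
    have hsum : F * X * F + F * Y * F = 0 := by
      rw [← Matrix.add_mul, ← Matrix.mul_add, ← hXY, hFSF]
    have hFX : F * X * F = 0 := by
      have h1 := hX.mul_mul_conjTranspose_same F
      have h2 := hY.mul_mul_conjTranspose_same F
      rw [hFH] at h1 h2
      open scoped MatrixOrder in
      exact le_antisymm (by
        rw [Matrix.le_iff, zero_sub, neg_eq_of_add_eq_zero_right hsum]; exact h2)
        (by rw [Matrix.le_iff, sub_zero]; exact h1)
    have haF : a * F = 0 := by
      rw [← conjTranspose_mul_self_eq_zero, conjTranspose_mul, hFH, haH, ← hFX, ← haa]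
      simp only [Matrix.mul_assoc]
    refine ⟨a * T, ?_, ?_⟩
    · rw [conjTranspose_mul, hTH, haH]
      calc a * T * S * (T * a) = a * (T * S * T) * a := by simp only [Matrix.mul_assoc]
        _ = X := by rw [hTST, Matrix.mul_sub, haF, Matrix.mul_one, sub_zero, haa]
    · rw [conjTranspose_mul, hTH, haH, ← haa]
      simp only [Matrix.mul_assoc]
  obtain ⟨C, hC, hC'⟩ := factor hA hB hSdef
  obtain ⟨D, hD, hD'⟩ := factor hB hA (hSdef.trans (add_comm A B))
  refine ⟨C, D, hC, hD, ?_⟩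
  rwa [hC', hD', ← Matrix.add_mul, ← Matrix.mul_add, ← hSdef, hTST, sub_sub_cancel]

end Matrix

/-- If `g : [0,∞) → [0,∞)` is convex with `g(0) = 0` and `A, B` are `n×n`
positive semidefinite complex matrices, then there exist unitaries `U, V` with
`g(A+B) ≥ U g(A) U* + V g(B) V*` in the Loewner order. -/
theorem convex_superadditive_unitary_orbits {n : ℕ} (g : ℝ → ℝ)
    (hg_nonneg : ∀ x ∈ Set.Ici (0:ℝ), 0 ≤ g x)
    (hg_convex : ConvexOn ℝ (Set.Ici 0) g)
    (hg0 : g 0 = 0)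
    (A B : Matrix (Fin n) (Fin n) ℂ)
    (hA : A.PosSemidef) (hB : B.PosSemidef) :
    ∃ U V : Matrix (Fin n) (Fin n) ℂ,
      U ∈ Matrix.unitaryGroup (Fin n) ℂ ∧ V ∈ Matrix.unitaryGroup (Fin n) ℂ ∧
      (cfc g (A + B) - (U * cfc g A * Uᴴ + V * cfc g B * Vᴴ)).PosSemidef := by
  obtain ⟨C, D, hC, hD, hCD⟩ := hA.exists_contractions hB
  have hS := hA.add hB
  have hC1 : (1 - Cᴴ * C).PosSemidef := by
    convert hCD.add (Matrix.posSemidef_conjTranspose_mul_self D) using 1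
    abel
  have hD1 : (1 - Dᴴ * D).PosSemidef := by
    convert hCD.add (Matrix.posSemidef_conjTranspose_mul_self C) using 1
    abel
  obtain ⟨U, hU, hUC⟩ :=
    hS.exists_unitary_posSemidef_sub_contraction hg_nonneg hg_convex hg0 hC1
  obtain ⟨V, hV, hVD⟩ :=
    hS.exists_unitary_posSemidef_sub_contraction hg_nonneg hg_convex hg0 hD1
  rw [hC] at hUC
  rw [hD] at hVD
  refine ⟨U, V, hU, hV, ?_⟩
  have hR := hCD.mul_mul_conjTranspose_same (cfc (fun x ↦ √(g x)) (A + B))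
  rw [Matrix.isHermitian_cfc _ (A + B)] at hR
  convert (hR.add hUC).add hVD using 1
  rw [← hS.cfc_sqrt_mul_self hg_nonneg]
  noncomm_ring
end

section
/- Let Φ : M_n(ℂ) → M_m(ℂ) be a unital positive linear map, let Ω ⊆ ℝ be an interval, let f be a concave function on Ω, and let A be an n×n Hermitian matrix whose spectrum is contained in Ω. Then there exist unitary matrices U, V ∈ M_m(ℂ) such that f(Φ(A)) ≥ (U Φ(f(A)) U* + V Φ(f(A)) V*)/2 in the Loewner order. -/
open scoped Matrix ComplexOrder

namespace Matrix

variable {ι κ : Type*} [Fintype ι] [Fintype κ]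

/-- The real part of the quadratic form `X ↦ ⟨x, X x⟩`, as a real linear functional of the
matrix `X`. -/
noncomputable def reQuadForm (x : ι → ℂ) : Matrix ι ι ℂ →ₗ[ℝ] ℝ where
  toFun X := (star x ⬝ᵥ X *ᵥ x).re
  map_add' X Y := by simp [add_mulVec, dotProduct_add]
  map_smul' r X := by simp [smul_mulVec, dotProduct_smul]

lemma reQuadForm_apply (x : ι → ℂ) (X : Matrix ι ι ℂ) :
    reQuadForm x X = (star x ⬝ᵥ X *ᵥ x).re := rfl

lemma reQuadForm_conjTranspose_mul_mul (x : ι → ℂ) (X : Matrix κ κ ℂ) (M : Matrix κ ι ℂ) :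
    reQuadForm x (Mᴴ * X * M) = reQuadForm (M *ᵥ x) X := by
  simp only [reQuadForm_apply, star_mulVec, dotProduct_mulVec, vecMul_vecMul, Matrix.mul_assoc]

lemma reQuadForm_diagonal [DecidableEq ι] (x : ι → ℂ) (d : ι → ℝ) :
    reQuadForm x (diagonal fun i => (d i : ℂ)) = ∑ i, ‖x i‖ ^ 2 * d i := by
  simp only [reQuadForm_apply, dotProduct, mulVec_diagonal, Complex.re_sum]
  refine Finset.sum_congr rfl fun i _ => ?_
  rw [← Complex.normSq_eq_norm_sq, Complex.normSq_apply]
  simp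
  ring

lemma reQuadForm_one [DecidableEq ι] (x : ι → ℂ) :
    reQuadForm x 1 = ∑ i, ‖x i‖ ^ 2 := by
  simpa using reQuadForm_diagonal x (fun _ => 1)

lemma reQuadForm_one_pos [DecidableEq ι] {x : ι → ℂ} (hx : x ≠ 0) : 0 < reQuadForm x 1 := by
  obtain ⟨i, hi⟩ := Function.ne_iff.mp hx
  rw [reQuadForm_one]
  exact Finset.sum_pos' (fun i _ => by positivity)
    ⟨i, Finset.mem_univ i, by have : 0 < ‖x i‖ := norm_pos_iff.mpr hi
                              positivity⟩

lemma reQuadForm_add_add_reQuadForm_sub (x y : ι → ℂ) (X : Matrix ι ι ℂ) :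
    reQuadForm (x + y) X + reQuadForm (x - y) X = 2 * (reQuadForm x X + reQuadForm y X) := by
  simp only [reQuadForm_apply, star_add, star_sub, mulVec_add, mulVec_sub, add_dotProduct,
    sub_dotProduct, dotProduct_add, dotProduct_sub, Complex.add_re, Complex.sub_re]
  ring

/-- Jensen's inequality for a positive operator valued measure with finite support. -/
lemma reQuadForm_jensen [DecidableEq κ] {Ω : Set ℝ} {f : ℝ → ℝ} (hf : ConcaveOn ℝ Ω f)
    {Q : ι → Matrix κ κ ℂ} (hQ : ∀ i, (Q i).PosSemidef) (hQ_one : ∑ i, Q i = 1)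
    {a : ι → ℝ} (ha : ∀ i, a i ∈ Ω) {x : κ → ℂ} (hx : x ≠ 0) :
    reQuadForm x (∑ i, a i • Q i) / reQuadForm x 1 ∈ Ω ∧
      reQuadForm x (∑ i, f (a i) • Q i) ≤
        reQuadForm x 1 * f (reQuadForm x (∑ i, a i • Q i) / reQuadForm x 1) := by
  have hpos := reQuadForm_one_pos hx
  have hw : ∀ i ∈ Finset.univ, 0 ≤ reQuadForm x (Q i) := fun i _ =>
    (Complex.le_def.mp ((hQ i).dotProduct_mulVec_nonneg x)).1
  have hsum : ∑ i, reQuadForm x (Q i) = reQuadForm x 1 := by rw [← map_sum, hQ_one]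
  have hmass (g : ι → ℝ) : Finset.univ.centerMass (fun i => reQuadForm x (Q i)) g =
      reQuadForm x (∑ i, g i • Q i) / reQuadForm x 1 := by
    simp [Finset.centerMass, hsum, div_eq_inv_mul, mul_comm]
  rw [← hsum] at hpos
  have hmem := hf.1.centerMass_mem hw hpos fun i _ => ha i
  have hle := hf.le_map_centerMass hw hpos fun i _ => ha i
  rw [hmass] at hmem hle
  rw [hmass] at hle
  refine ⟨hmem, ?_⟩
  rw [hsum] at hpos
  rwa [div_le_iff₀' hpos] at hle

/-- If the quadratic form of a Hermitian matrix `Y` is at most `c` on the coordinate subspace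
spanned by the coordinates with `d i ≤ c`, for every `c`, then a unitary conjugate of `Y` is
dominated by the diagonal matrix with entries `d`. -/
lemma exists_unitary_conj_le_diagonal {m : ℕ} {Y : Matrix (Fin m) (Fin m) ℂ}
    (hY : Y.IsHermitian) (d : Fin m → ℝ)
    (h : ∀ (c : ℝ) (x : Fin m → ℂ), (∀ i, x i ≠ 0 → d i ≤ c) →
      reQuadForm x Y ≤ c * reQuadForm x 1) :
    ∃ W ∈ unitaryGroup (Fin m) ℂ,
      (diagonal (fun i => (d i : ℂ)) - W * Y * Wᴴ).PosSemidef := by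
  set l := hY.eigenvalues
  set P : Matrix (Fin m) (Fin m) ℂ := hY.eigenvectorUnitary.1
  have hPP : Pᴴ * P = 1 := Unitary.coe_star_mul_self hY.eigenvectorUnitary
  have hYP : Pᴴ * Y * P = diagonal fun i => (l i : ℂ) := by
    have := hY.conjStarAlgAut_star_eigenvectorUnitary
    rwa [Unitary.conjStarAlgAut_star_apply] at this
  set σ := Tuple.sort d
  set τ := Tuple.sort l
  have hσ : Monotone (d ∘ σ) := Tuple.monotone_sort d
  have hτ : Monotone (l ∘ τ) := Tuple.monotone_sort l
  have key : ∀ k, l (τ k) ≤ d (σ k) := by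
    intro k
    by_contra! hlt
    let T : (Set.Ici k → ℂ) →ₗ[ℂ] (Fin m → ℂ) :=
      (Matrix.mulVecLin (P.submatrix id τ)) ∘ₗ
        (Function.ExtendByZero.linearMap ℂ (Subtype.val : Set.Ici k → Fin m))
    let R : (Set.Ici k → ℂ) →ₗ[ℂ] (Set.Ioi k → ℂ) :=
      LinearMap.funLeft ℂ ℂ (fun j : Set.Ioi k => σ j) ∘ₗ T
    have hR : LinearMap.ker R ≠ ⊥ := by
      apply LinearMap.ker_ne_bot_of_finrank_lt
      simp only [Module.finrank_fintype_fun_eq_card, Fintype.card_Ici, Fintype.card_Ioi]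
      simp
      omega
    obtain ⟨u, hu, hu0⟩ := (Submodule.ne_bot_iff _).mp hR
    set v : Fin m → ℂ := Function.extend Subtype.val u 0 with hv
    have hvz : ∀ j, j < k → v j = 0 := fun j hj =>
      Function.extend_apply' _ _ _ (by rintro ⟨⟨i, hi⟩, rfl⟩; exact absurd hj (not_lt.mpr hi))
    have hv0 : v ≠ 0 := by
      obtain ⟨i, hi⟩ := Function.ne_iff.mp hu0
      refine Function.ne_iff.mpr ⟨i, ?_⟩
      rw [hv, Subtype.val_injective.extend_apply]
      exact hi
    set N := P.submatrix id τ with hN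
    have hNN : Nᴴ * N = 1 := by
      rw [hN, conjTranspose_submatrix, submatrix_mul _ _ _ _ _ Function.bijective_id |>.symm, hPP]
      simp
    have hNY : Nᴴ * Y * N = diagonal fun i => (l (τ i) : ℂ) := by
      have : Nᴴ * Y * N = (Pᴴ * Y * P).submatrix τ τ := by
        ext i j; simp [hN, Matrix.mul_apply]
      rw [this, hYP]
      simp [Function.comp_def]
    have hx := h (d (σ k)) (N *ᵥ v) (by
      intro i hi
      by_contra! hd
      apply hi
      have hk : k < σ.symm i := by
        by_contra! hle
        have := hσ hle
        simp at this
        linarith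
      have := congrFun (LinearMap.mem_ker.mp hu) ⟨σ.symm i, hk⟩
      simp only [R, LinearMap.comp_apply, LinearMap.funLeft_apply, Equiv.apply_symm_apply] at this
      exact this)
    have h1 : reQuadForm (N *ᵥ v) 1 = reQuadForm v 1 := by
      rw [← reQuadForm_conjTranspose_mul_mul, Matrix.mul_one, hNN]
    rw [h1, ← reQuadForm_conjTranspose_mul_mul, hNY, reQuadForm_diagonal] at hx
    have h2 : l (τ k) * reQuadForm v 1 ≤ ∑ i, ‖v i‖ ^ 2 * l (τ i) := by
      rw [reQuadForm_one, Finset.mul_sum]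
      refine Finset.sum_le_sum fun i _ => ?_
      rcases lt_or_ge i k with hi | hi
      · simp [hvz i hi]
      · rw [mul_comm]
        exact mul_le_mul_of_nonneg_left (hτ hi) (by positivity)
    nlinarith [reQuadForm_one_pos hv0]
  let π : Equiv.Perm (Fin m) := σ.symm.trans τ
  have hπ : ∀ i, l (π i) ≤ d i := fun i => by simpa [π] using key (σ.symm i)
  refine ⟨(P.submatrix id π)ᴴ, ?_, ?_⟩
  · rw [mem_unitaryGroup_iff, star_eq_conjTranspose, conjTranspose_conjTranspose,
      conjTranspose_submatrix, submatrix_mul _ _ _ _ _ Function.bijective_id |>.symm, hPP]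
    simp
  · have : (P.submatrix id π)ᴴ * Y * (P.submatrix id π)ᴴᴴ = (Pᴴ * Y * P).submatrix π π := by
      ext i j; simp [Matrix.mul_apply]
    rw [this, hYP, submatrix_diagonal_equiv, diagonal_sub]
    refine PosSemidef.diagonal fun i => ?_
    simpa using hπ i

end Matrix

lemma Finset.exists_pos_weight_le_of_le_sum_div {ι : Type*} {s : Finset ι} {w b : ι → ℝ}
    (hw : ∀ i ∈ s, 0 ≤ w i) (hs : 0 < ∑ i ∈ s, w i) {t : ℝ}
    (ht : t = (∑ i ∈ s, w i * b i) / ∑ i ∈ s, w i) :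
    ∃ i ∈ s, 0 < w i ∧ t ≤ b i := by
  by_contra! hcon
  obtain ⟨j, hj, hjw⟩ : ∃ j ∈ s, 0 < w j := by
    by_contra! hle
    exact absurd hs (not_lt.mpr (Finset.sum_nonpos hle))
  have : ∑ i ∈ s, w i * b i < ∑ i ∈ s, w i * t := by
    refine Finset.sum_lt_sum (fun i hi => ?_)
      ⟨j, hj, mul_lt_mul_of_pos_left (hcon j hj hjw) hjw⟩
    rcases (hw i hi).eq_or_lt with h0 | h0
    · simp [← h0]
    · exact mul_le_mul_of_nonneg_left (hcon i hi h0).le h0.le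
  rw [← Finset.sum_mul, ht, mul_div_cancel₀ _ hs.ne'] at this
  exact lt_irrefl _ this

lemma ConcaveOn.right_le_of_lt_left {Ω : Set ℝ} {f : ℝ → ℝ} (hf : ConcaveOn ℝ Ω f) {x y z : ℝ}
    (hx : x ∈ Ω) (hz : z ∈ Ω) (hxy : x ≤ y) (hyz : y ≤ z) (h : f y < f x) : f z ≤ f y := by
  have := hf.min_le_of_mem_Icc hx hz ⟨hxy, hyz⟩
  rcases min_le_iff.mp this with h' | h'
  · exact absurd h (not_lt.mpr h')
  · exact h'

namespace Matrix

variable {ι : Type*} [Fintype ι]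

/-- The result in an eigenbasis of the barycenter of the positive operator valued measure `Q`. -/
lemma exists_unitary_pair_conj_le_diagonal {m : ℕ} {Ω : Set ℝ} {f : ℝ → ℝ}
    (hf : ConcaveOn ℝ Ω f) {Q : ι → Matrix (Fin m) (Fin m) ℂ} (hQ : ∀ i, (Q i).PosSemidef)
    (hQ_one : ∑ i, Q i = 1) {a : ι → ℝ} (ha : ∀ i, a i ∈ Ω) {b : Fin m → ℝ}
    (hb : ∑ i, a i • Q i = diagonal fun i => (b i : ℂ)) :
    ∃ U ∈ unitaryGroup (Fin m) ℂ, ∃ V ∈ unitaryGroup (Fin m) ℂ,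
      (diagonal (fun i => (f (b i) : ℂ)) - (1 / 2 : ℂ) •
        (U * (∑ i, f (a i) • Q i) * Uᴴ + V * (∑ i, f (a i) • Q i) * Vᴴ)).PosSemidef := by
  classical
  set Y := ∑ i, f (a i) • Q i
  have hY : Y.IsHermitian := by
    refine isSelfAdjoint_sum _ fun i _ => ?_
    exact (IsSelfAdjoint.all (f (a i))).smul (hQ i).1
  let E : Fin m → Prop := fun i => ∀ x ∈ Ω, x ≤ b i → f x ≤ f (b i)
  let S : Matrix (Fin m) (Fin m) ℂ := diagonal fun i => if E i then 1 else -1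
  have hSh : Sᴴ = S := by
    rw [diagonal_conjTranspose]
    congr 1
    ext i
    by_cases hi : E i <;> simp [hi]
  have hSS : S * S = 1 := by
    rw [diagonal_mul_diagonal, ← diagonal_one]
    congr 1
    ext i
    by_cases hi : E i <;> simp [hi]
  have hbar {x : Fin m → ℂ} (hx : x ≠ 0) := reQuadForm_jensen hf hQ hQ_one ha hx
  rw [hb] at hbar
  have hF (i : Fin m) (hi : ¬ E i) : ∀ y ∈ Ω, b i ≤ y → f y ≤ f (b i) := by
    simp only [E] at hi
    push Not at hi
    obtain ⟨x, hx, hxb, hlt⟩ := hi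
    exact fun y hy hby => hf.right_le_of_lt_left hx hy hxb hby hlt
  have bound (c : ℝ) (x : Fin m → ℂ)
      (hdir : (∀ i, x i ≠ 0 → f (b i) ≤ c ∧ E i) ∨ (∀ i, x i ≠ 0 → f (b i) ≤ c ∧ ¬ E i)) :
      reQuadForm x Y ≤ c * reQuadForm x 1 := by
    by_cases hx : x = 0
    · simp [hx, reQuadForm_apply]
    obtain ⟨hmem, hle⟩ := hbar hx
    have hpos := reQuadForm_one_pos hx
    set t := reQuadForm x (diagonal fun i => (b i : ℂ)) / reQuadForm x 1 with ht
    suffices f t ≤ c by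
      calc _ ≤ _ := hle
        _ ≤ _ := by rw [mul_comm]; exact mul_le_mul_of_nonneg_right this hpos.le
    rw [reQuadForm_diagonal, reQuadForm_one] at ht
    rw [reQuadForm_one] at hpos
    rcases hdir with hdir | hdir
    · obtain ⟨i, -, hi, hti⟩ := Finset.exists_pos_weight_le_of_le_sum_div
        (fun i _ => by positivity) hpos ht
      obtain ⟨hc, hE⟩ := hdir i (by rintro h0; simp [h0] at hi)
      exact (hE t hmem hti).trans hc
    · obtain ⟨i, -, hi, hti⟩ := Finset.exists_pos_weight_le_of_le_sum_div (b := fun i => -b i)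
        (fun i _ => by positivity) hpos (t := -t) (by rw [ht]; simp [neg_div])
      obtain ⟨hc, hE⟩ := hdir i (by rintro h0; simp [h0] at hi)
      exact (hF i hE t hmem (neg_le_neg_iff.mp hti)).trans hc
  have hpinch : ((1 / 2 : ℝ) • (Y + S * Y * S)).IsHermitian := by
    refine (IsSelfAdjoint.all (1 / 2 : ℝ)).smul (hY.add ?_)
    have := isHermitian_conjTranspose_mul_mul S hY
    rwa [hSh] at this
  obtain ⟨W, hW, hle⟩ := exists_unitary_conj_le_diagonal hpinch (fun i => f (b i)) (by
    intro c x hx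
    set y : Fin m → ℂ := fun i => if E i then x i else 0 with hy
    set z : Fin m → ℂ := fun i => if E i then 0 else x i with hz
    have hyz : y + z = x := by ext i; by_cases hi : E i <;> simp [hy, hz, hi]
    have hyz' : S *ᵥ x = y - z := by
      ext i; by_cases hi : E i <;> simp [S, mulVec_diagonal, hy, hz, hi]
    have h1 : reQuadForm x (S * Y * S) = reQuadForm (y - z) Y := by
      rw [← hyz', ← reQuadForm_conjTranspose_mul_mul, hSh]
    have h2 : reQuadForm x 1 = reQuadForm (y - z) 1 := by
      rw [← hyz', ← reQuadForm_conjTranspose_mul_mul, hSh, Matrix.mul_one, hSS]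
    have h3 := reQuadForm_add_add_reQuadForm_sub y z Y
    have h4 := reQuadForm_add_add_reQuadForm_sub y z 1
    have h5 := bound c y (.inl fun i hi => by
      by_cases hE : E i
      · exact ⟨hx i (by simpa [hy, hE] using hi), hE⟩
      · simp [hy, hE] at hi)
    have h6 := bound c z (.inr fun i hi => by
      by_cases hE : E i
      · simp [hz, hE] at hi
      · exact ⟨hx i (by simpa [hz, hE] using hi), hE⟩)
    rw [map_smul, map_add, h1]
    rw [hyz] at h3 h4
    rw [← h2] at h4
    rw [smul_eq_mul]
    have h7 : reQuadForm x 1 = reQuadForm y 1 + reQuadForm z 1 := by linarith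
    rw [h7]
    linarith)
  refine ⟨W, hW, W * S, mul_mem hW ?_, ?_⟩
  · rw [mem_unitaryGroup_iff, star_eq_conjTranspose, hSh, hSS]
  · convert hle using 2
    rw [conjTranspose_mul, hSh]
    have : (1 / 2 : ℝ) • (Y + S * Y * S) = (1 / 2 : ℂ) • (Y + S * Y * S) := by
      ext i j; simp [mul_add]
    rw [this]
    simp only [Matrix.mul_smul, Matrix.smul_mul, Matrix.mul_add, Matrix.add_mul, Matrix.mul_assoc]

lemma IsHermitian.cfc_eq_conj [DecidableEq ι] {A : Matrix ι ι ℂ} (hA : A.IsHermitian)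
    (f : ℝ → ℝ) :
    cfc f A = (hA.eigenvectorUnitary : Matrix ι ι ℂ) *
      diagonal (fun i => (f (hA.eigenvalues i) : ℂ)) *
      (hA.eigenvectorUnitary : Matrix ι ι ℂ)ᴴ := by
  rw [hA.cfc_eq, IsHermitian.cfc, Unitary.conjStarAlgAut_apply]
  rfl

lemma mul_diagonal_mul_conjTranspose_eq_sum [DecidableEq ι] (P : Matrix ι ι ℂ) (d : ι → ℝ) :
    P * diagonal (fun i => (d i : ℂ)) * Pᴴ =
      ∑ i, (d i : ℂ) • vecMulVec (P.col i) (star (P.col i)) := by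
  ext j k
  rw [Matrix.mul_apply, Matrix.sum_apply]
  refine Finset.sum_congr rfl fun i _ => ?_
  simp [vecMulVec_apply]
  ring

end Matrix

/-- If `Φ : M_n(ℂ) → M_m(ℂ)` is a unital positive linear map, `Ω` an
interval, `f` concave on `Ω`, and `A` Hermitian with spectrum in `Ω`, then there exist
unitaries `U, V ∈ M_m(ℂ)` with `f(Φ(A)) ≥ (U Φ(f(A)) U* + V Φ(f(A)) V*)/2`. -/
theorem concave_unital_positive_map_unitary_orbits {n m : ℕ}
    (Φ : Matrix (Fin n) (Fin n) ℂ →ₗ[ℂ] Matrix (Fin m) (Fin m) ℂ)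
    (hΦ_unital : Φ 1 = 1)
    (hΦ_pos : ∀ A : Matrix (Fin n) (Fin n) ℂ, A.PosSemidef → (Φ A).PosSemidef)
    (Ω : Set ℝ) (hΩ : Ω.OrdConnected)
    (f : ℝ → ℝ) (hf_concave : ConcaveOn ℝ Ω f)
    (A : Matrix (Fin n) (Fin n) ℂ) (hA : A.IsHermitian)
    (hspec : spectrum ℝ A ⊆ Ω) :
    ∃ U V : Matrix (Fin m) (Fin m) ℂ,
      U ∈ Matrix.unitaryGroup (Fin m) ℂ ∧ V ∈ Matrix.unitaryGroup (Fin m) ℂ ∧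
      (cfc f (Φ A) -
        ((1/2 : ℂ) • (U * Φ (cfc f A) * Uᴴ + V * Φ (cfc f A) * Vᴴ))).PosSemidef := by
  set R : Matrix (Fin n) (Fin n) ℂ := hA.eigenvectorUnitary.1
  set a := hA.eigenvalues
  let p : Fin n → Matrix (Fin n) (Fin n) ℂ := fun i => Matrix.vecMulVec (R.col i) (star (R.col i))
  have hcfc (g : ℝ → ℝ) : Φ (cfc g A) = ∑ i, g (a i) • Φ (p i) := by
    rw [hA.cfc_eq_conj, Matrix.mul_diagonal_mul_conjTranspose_eq_sum, map_sum]
    refine Finset.sum_congr rfl fun i _ => ?_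
    rw [map_smul, Complex.coe_smul]
  have hone : ∑ i, Φ (p i) = 1 := by
    rw [← hΦ_unital, ← cfc_one ℝ A hA.isSelfAdjoint]
    simpa using (hcfc 1).symm
  have hbar : Φ A = ∑ i, a i • Φ (p i) := by
    simpa [cfc_id ℝ A hA.isSelfAdjoint] using hcfc id
  have hp (i : Fin n) : (Φ (p i)).PosSemidef :=
    hΦ_pos _ (Matrix.posSemidef_vecMulVec_self_star _)
  have hB : (Φ A).IsHermitian := by
    rw [hbar]
    exact isSelfAdjoint_sum _ fun i _ => (IsSelfAdjoint.all (a i)).smul (hp i).1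
  set P : Matrix (Fin m) (Fin m) ℂ := hB.eigenvectorUnitary.1
  have hPmem : P ∈ Matrix.unitaryGroup (Fin m) ℂ := hB.eigenvectorUnitary.2
  have hPmem' : Pᴴ ∈ Matrix.unitaryGroup (Fin m) ℂ := Unitary.star_mem hPmem
  have hPP : Pᴴ * P = 1 := Unitary.coe_star_mul_self hB.eigenvectorUnitary
  have hsum (g : Fin n → ℝ) :
      ∑ i, g i • (Pᴴ * Φ (p i) * P) = Pᴴ * (∑ i, g i • Φ (p i)) * P := by
    simp [Matrix.mul_sum, Matrix.sum_mul]
  obtain ⟨U, hU, V, hV, hle⟩ := Matrix.exists_unitary_pair_conj_le_diagonal hf_concave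
    (Q := fun i => Pᴴ * Φ (p i) * P) (a := a) (b := hB.eigenvalues)
    (fun i => (hp i).conjTranspose_mul_mul_same P)
    (by simpa [hone, hPP] using hsum 1)
    (fun i => hspec (hA.eigenvalues_mem_spectrum_real i))
    (by
      rw [hsum, ← hbar]
      have := hB.conjStarAlgAut_star_eigenvectorUnitary
      rwa [Unitary.conjStarAlgAut_star_apply] at this)
  refine ⟨P * U * Pᴴ, P * V * Pᴴ, mul_mem (mul_mem hPmem hU) hPmem',
    mul_mem (mul_mem hPmem hV) hPmem', ?_⟩
  convert hle.mul_mul_conjTranspose_same P using 1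
  rw [hsum, ← hcfc, hB.cfc_eq_conj]
  simp only [Matrix.mul_sub, Matrix.sub_mul, Matrix.mul_smul, Matrix.smul_mul, Matrix.mul_add,
    Matrix.add_mul, Matrix.mul_assoc, Matrix.conjTranspose_mul, Matrix.conjTranspose_conjTranspose]
  rfl
end

section
/- Let g : [0,∞) → [0,∞) be a convex function with g(0) = 0, let A, B be n×n positive semidefinite complex matrices, and let ‖·‖_! be a symmetric anti-norm. Then ‖g(A+B)‖_! ≥ ‖g(A)‖_! + ‖g(B)‖_!. -/
open scoped Matrix ComplexOrder

/-- A symmetric anti-norm on the cone of positive semidefinite complex matrices. -/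
def IsSymmetricAntiNorm {k : Type*} [Fintype k] [DecidableEq k]
    (N : Matrix k k ℂ → ℝ) : Prop :=
  (∀ A : Matrix k k ℂ, A.PosSemidef → 0 ≤ N A) ∧
  (∀ (c : ℝ), 0 ≤ c → ∀ A : Matrix k k ℂ, A.PosSemidef → N (c • A) = c * N A) ∧
  (∀ A B : Matrix k k ℂ, A.PosSemidef → B.PosSemidef → N A + N B ≤ N (A + B)) ∧
  (∀ (U A : Matrix k k ℂ), U ∈ Matrix.unitaryGroup k ℂ → A.PosSemidef →
    N (U * A * Uᴴ) = N A)

open scoped MatrixOrder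

namespace Matrix

variable {k : Type*} [Fintype k] [DecidableEq k]

/-- The quadratic form of a Hermitian matrix in the coordinates of its eigenbasis. -/
lemma IsHermitian.re_dotProduct_mulVec_eq_sum {A : Matrix k k ℂ} (hA : A.IsHermitian)
    (x : k → ℂ) :
    (star x ⬝ᵥ A *ᵥ x).re = ∑ j, hA.eigenvalues j *
      ‖((star (hA.eigenvectorUnitary : Matrix k k ℂ)) *ᵥ x) j‖ ^ 2 := by
  set U : Matrix k k ℂ := (hA.eigenvectorUnitary : Matrix k k ℂ) with hU
  have h : A = U * diagonal (RCLike.ofReal ∘ hA.eigenvalues) * star U := by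
    conv_lhs => rw [hA.spectral_theorem, Unitary.conjStarAlgAut_apply]
  have h2 : star x ⬝ᵥ A *ᵥ x =
      star (star U *ᵥ x) ⬝ᵥ (diagonal (RCLike.ofReal ∘ hA.eigenvalues) *ᵥ (star U *ᵥ x)) := by
    conv_lhs => rw [h]
    rw [star_mulVec, ← dotProduct_mulVec, star_eq_conjTranspose, conjTranspose_conjTranspose,
      mulVec_mulVec, mulVec_mulVec, mul_assoc]
  rw [h2, dotProduct, Complex.re_sum]
  refine Finset.sum_congr rfl fun j _ => ?_
  rw [mulVec_diagonal, Complex.sq_norm, Complex.normSq_apply]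
  simp
  ring

lemma IsHermitian.re_dotProduct_self_eq_sum {A : Matrix k k ℂ} (hA : A.IsHermitian)
    (x : k → ℂ) :
    (star x ⬝ᵥ x).re =
      ∑ j, ‖((star (hA.eigenvectorUnitary : Matrix k k ℂ)) *ᵥ x) j‖ ^ 2 := by
  set U : Matrix k k ℂ := (hA.eigenvectorUnitary : Matrix k k ℂ) with hU
  have h2 : star x ⬝ᵥ x = star (star U *ᵥ x) ⬝ᵥ (star U *ᵥ x) := by
    rw [star_mulVec, ← dotProduct_mulVec, star_eq_conjTranspose, conjTranspose_conjTranspose,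
      mulVec_mulVec, ← star_eq_conjTranspose, hU, Unitary.mul_star_self_of_mem hA.eigenvectorUnitary.2,
      one_mulVec]
  rw [h2, dotProduct, Complex.re_sum]
  refine Finset.sum_congr rfl fun j _ => ?_
  rw [Complex.sq_norm, Complex.normSq_apply]
  simp

/-- Weyl monotonicity: if `α A - β ≤ M` with `α ≥ 0`, the same holds for the ordered
eigenvalues. -/
lemma IsHermitian.eigenvalues_affine_le {A M : Matrix k k ℂ} (hA : A.IsHermitian)
    (hM : M.IsHermitian) {α β : ℝ} (hα : 0 ≤ α) (h : α • A - β • (1 : Matrix k k ℂ) ≤ M) (i : k) :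
    α * hA.eigenvalues i - β ≤ hM.eigenvalues i := by
  set e := (Fintype.equivOfCardEq (Fintype.card_fin (Fintype.card k))).symm with he
  have hanti : ∀ {B : Matrix k k ℂ} (hB : B.IsHermitian) {j l : k}, e j ≤ e l →
      hB.eigenvalues l ≤ hB.eigenvalues j := fun hB _ _ hjl => hB.eigenvalues₀_antitone hjl
  set UA : Matrix k k ℂ := star (hA.eigenvectorUnitary : Matrix k k ℂ) with hUA
  set UM : Matrix k k ℂ := star (hM.eigenvectorUnitary : Matrix k k ℂ) with hUM
  let L : (k → ℂ) →ₗ[ℂ] ({j : k // j ≠ i} → ℂ) :=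
    LinearMap.pi fun j => if e i < e j.1 then LinearMap.proj j.1 ∘ₗ UA.mulVecLin
      else LinearMap.proj j.1 ∘ₗ UM.mulVecLin
  have hker : LinearMap.ker L ≠ ⊥ := by
    apply LinearMap.ker_ne_bot_of_finrank_lt
    rw [Module.finrank_fintype_fun_eq_card, Module.finrank_fintype_fun_eq_card]
    exact Fintype.card_subtype_lt (x := i) (by simp)
  obtain ⟨x, hx, hx0⟩ := Submodule.exists_mem_ne_zero_of_ne_bot hker
  have hxj : ∀ j : k, j ≠ i → (if e i < e j then (UA *ᵥ x) j else (UM *ᵥ x) j) = 0 := by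
    intro j hj
    have := congrFun (LinearMap.mem_ker.mp hx) ⟨j, hj⟩
    simp only [L, LinearMap.pi_apply, Pi.zero_apply] at this
    split_ifs at this ⊢ <;> simpa using this
  have hxpos : 0 < (star x ⬝ᵥ x).re :=
    (Complex.lt_def.mp (dotProduct_star_self_pos_iff.mpr hx0)).1
  have hlow : hA.eigenvalues i * (star x ⬝ᵥ x).re ≤ (star x ⬝ᵥ A *ᵥ x).re := by
    rw [hA.re_dotProduct_mulVec_eq_sum, hA.re_dotProduct_self_eq_sum, Finset.mul_sum]
    refine Finset.sum_le_sum fun j _ => ?_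
    by_cases hij : e i < e j
    · have := hxj j (by rintro rfl; exact lt_irrefl _ hij)
      rw [if_pos hij] at this
      simp [← hUA, this]
    · exact mul_le_mul_of_nonneg_right (hanti hA (not_lt.mp hij)) (by positivity)
  have hupp : (star x ⬝ᵥ M *ᵥ x).re ≤ hM.eigenvalues i * (star x ⬝ᵥ x).re := by
    rw [hM.re_dotProduct_mulVec_eq_sum, hM.re_dotProduct_self_eq_sum, Finset.mul_sum]
    refine Finset.sum_le_sum fun j _ => ?_
    by_cases hij : e i ≤ e j
    · exact mul_le_mul_of_nonneg_right (hanti hM hij) (by positivity)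
    · have := hxj j (by rintro rfl; exact hij le_rfl)
      rw [if_neg fun h' => hij h'.le] at this
      simp [← hUM, this]
  have hform := (le_iff.mp h).re_dotProduct_nonneg x
  simp only [sub_mulVec, dotProduct_sub, smul_mulVec, dotProduct_smul, one_mulVec, map_sub,
    RCLike.re_to_complex, Complex.real_smul, Complex.re_ofReal_mul] at hform
  have := mul_le_mul_of_nonneg_left hlow hα
  refine le_of_mul_le_mul_right ?_ hxpos
  linarith

lemma mul_conjTranspose_le_one {Y : Matrix k k ℂ} (h : Yᴴ * Y ≤ 1) : Y * Yᴴ ≤ 1 := by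
  let : Invertible (1 : Matrix k k ℂ) := invertibleOne
  have h1 : (fromBlocks (1 : Matrix k k ℂ) Y Yᴴ 1).PosSemidef := by
    rw [PosDef.one.fromBlocks₁₁]
    simpa using le_iff.mp h
  rw [PosDef.one.fromBlocks₂₂] at h1
  exact le_iff.mpr (by simpa using h1)

lemma IsHermitian.conj_eq_of_mul_self_le {A S E R : Matrix k k ℂ} (hAS : A ≤ S)
    (hR : R.IsHermitian) (hRA : R * R = A) (hE : E.IsHermitian)
    (hSE : S * E = S) : R * E * R = A := by
  have hFS : (1 - E) * S * (1 - E) = 0 := by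
    rw [mul_assoc, mul_sub, mul_one, hSE, sub_self, mul_zero]
  have hF : (1 - E).IsHermitian := isHermitian_one.sub hE
  have h0 : (R * (1 - E))ᴴ * (R * (1 - E)) = 0 := by
    apply le_antisymm
    · have := (le_iff.mp hAS).mul_mul_conjTranspose_same (1 - E)
      rw [hF.eq, mul_sub (1 - E) S A, sub_mul _ _ (1 - E), hFS] at this
      rw [le_iff, conjTranspose_mul, hF.eq, hR.eq]
      rw [← hRA] at this
      simpa [mul_assoc] using this
    · exact (posSemidef_conjTranspose_mul_self _).nonneg
  have h1 := conjTranspose_mul_self_eq_zero.mp h0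
  rw [mul_sub, mul_one, sub_eq_zero] at h1
  rw [← h1, hRA]

end Matrix

open Matrix

/-- A convex function on `[0, ∞)` vanishing at `0` and nonnegative has at each point a supporting
line with nonnegative slope and nonpositive intercept. -/
lemma ConvexOn.exists_supporting_line {g : ℝ → ℝ} (hg_nonneg : ∀ x ∈ Set.Ici (0 : ℝ), 0 ≤ g x)
    (hg : ConvexOn ℝ (Set.Ici 0) g) (hg0 : g 0 = 0) {t : ℝ} (ht : 0 ≤ t) :
    ∃ α β : ℝ, 0 ≤ α ∧ 0 ≤ β ∧ α * t - β = g t ∧ ∀ x, 0 ≤ x → α * x - β ≤ g x := by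
  rcases ht.eq_or_lt with rfl | ht
  · exact ⟨0, 0, le_rfl, le_rfl, by simp [hg0], fun x hx => by simpa using hg_nonneg x hx⟩
  have hmem : t ∈ interior (Set.Ici (0 : ℝ)) := by simpa using ht
  set α := derivWithin g (Set.Ioi t) t
  have hsupp : ∀ x, 0 ≤ x → α * x - (α * t - g t) ≤ g x := by
    intro x hx
    rcases lt_trichotomy x t with hxt | rfl | hxt
    · have h1 := hg.slope_le_leftDeriv_of_mem_interior hx hmem hxt
      have h2 := h1.trans (hg.leftDeriv_le_rightDeriv_of_mem_interior hmem)
      rw [slope_def_field, div_le_iff₀ (by linarith)] at h2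
      linarith
    · linarith
    · have h1 := hg.rightDeriv_le_slope_of_mem_interior hmem (y := x) hx hxt
      rw [slope_def_field, le_div_iff₀ (by linarith)] at h1
      linarith
  have hβ : 0 ≤ α * t - g t := by
    have := hsupp 0 le_rfl
    rw [hg0] at this
    linarith
  refine ⟨α, α * t - g t, ?_, hβ, by ring, hsupp⟩
  have := hg_nonneg t ht.le
  exact nonneg_of_mul_nonneg_left (by linarith : 0 ≤ α * t) ht

namespace IsSymmetricAntiNorm

variable {k : Type*} [Fintype k] [DecidableEq k] {N : Matrix k k ℂ → ℝ}

lemma le_of_eigenvalues_le (hN : IsSymmetricAntiNorm N) {A M : Matrix k k ℂ}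
    (hA : A.IsHermitian) (hM : M.IsHermitian) {g : ℝ → ℝ}
    (hg : ∀ i, 0 ≤ g (hA.eigenvalues i)) (h : ∀ i, g (hA.eigenvalues i) ≤ hM.eigenvalues i) :
    N (cfc g A) ≤ N M := by
  obtain ⟨hpos, -, hadd, hunit⟩ := hN
  have hd : ∀ d : k → ℝ, (∀ i, 0 ≤ d i) →
      (diagonal (RCLike.ofReal ∘ d) : Matrix k k ℂ).PosSemidef := fun d hd =>
    PosSemidef.diagonal fun i => by simpa using hd i
  have hM' : N M = N (diagonal (RCLike.ofReal ∘ hM.eigenvalues)) := by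
    conv_lhs => rw [hM.spectral_theorem, Unitary.conjStarAlgAut_apply]
    exact hunit _ _ hM.eigenvectorUnitary.2 (hd _ fun i => (hg i).trans (h i))
  have hA' : N (cfc g A) = N (diagonal (RCLike.ofReal ∘ (g ∘ hA.eigenvalues))) := by
    rw [hA.cfc_eq, IsHermitian.cfc, Unitary.conjStarAlgAut_apply]
    exact hunit _ _ hA.eigenvectorUnitary.2 (hd _ hg)
  have hdiff := hd (fun i => hM.eigenvalues i - g (hA.eigenvalues i)) fun i => sub_nonneg.mpr (h i)
  have := hadd _ _ (hd (g ∘ hA.eigenvalues) hg) hdiff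
  have hsum : diagonal (RCLike.ofReal ∘ (g ∘ hA.eigenvalues)) +
      diagonal (RCLike.ofReal ∘ fun i => hM.eigenvalues i - g (hA.eigenvalues i)) =
      (diagonal (RCLike.ofReal ∘ hM.eigenvalues) : Matrix k k ℂ) := by
    rw [diagonal_add]
    congr 1
    ext i
    simp
  rw [hM', hA', ← hsum]
  have := hpos _ hdiff
  linarith

/-- If `0 ≤ A ≤ S`, then `g(A)` is dominated by `K A K`, where `K = (g(S) / S)^{1/2}`. -/
lemma cfc_le_conj (hN : IsSymmetricAntiNorm N) {g : ℝ → ℝ}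
    (hg_nonneg : ∀ x ∈ Set.Ici (0 : ℝ), 0 ≤ g x) (hg : ConvexOn ℝ (Set.Ici 0) g) (hg0 : g 0 = 0)
    {A S : Matrix k k ℂ} (hA : A.PosSemidef) (hAS : A ≤ S) :
    N (cfc g A) ≤ N (cfc (fun x => √(g x / x)) S * A * cfc (fun x => √(g x / x)) S) := by
  have hc : ∀ f : ℝ → ℝ, ContinuousOn f (spectrum ℝ S) := fun f =>
    S.finite_real_spectrum.continuousOn f
  have hS : 0 ≤ S := hA.nonneg.trans hAS
  have hSsa : IsSelfAdjoint S := hS.posSemidef.isHermitian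
  have hspec : ∀ x ∈ spectrum ℝ S, 0 ≤ x := fun x hx => spectrum_nonneg_of_nonneg hS hx
  have hsa : ∀ f : ℝ → ℝ, (cfc f S).IsHermitian := fun f => cfc_predicate f S
  set K := cfc (fun x => √(g x / x)) S with hK
  have hKsa : K.IsHermitian := hsa _
  obtain ⟨R, hR, hRA⟩ : ∃ R : Matrix k k ℂ, R.IsHermitian ∧ R * R = A :=
    ⟨CFC.sqrt A, (CFC.sqrt_nonneg A).posSemidef.isHermitian, CFC.sqrt_mul_sqrt_self A hA.nonneg⟩
  set T := cfc (fun x : ℝ => √(x⁻¹)) S with hT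
  have hTsa : T.IsHermitian := hsa _
  set E := cfc (fun x : ℝ => x * x⁻¹) S with hE
  have hTT : T * T = cfc (fun x : ℝ => x⁻¹) S := by
    rw [hT, ← cfc_mul _ _ S (hc _) (hc _)]
    exact cfc_congr fun x hx => Real.mul_self_sqrt (inv_nonneg.mpr (hspec x hx))
  have hKK : K * K = cfc (fun x => g x / x) S := by
    rw [hK, ← cfc_mul _ _ S (hc _) (hc _)]
    exact cfc_congr fun x hx =>
      Real.mul_self_sqrt (div_nonneg (hg_nonneg x (hspec x hx)) (hspec x hx))
  have hTST : T * S * T = E := by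
    conv_lhs => rw [← cfc_id' ℝ S]
    rw [hT, ← cfc_mul _ _ S (hc _) (hc _), ← cfc_mul _ _ S (hc _) (hc _)]
    refine cfc_congr fun x hx => ?_
    have := Real.mul_self_sqrt (inv_nonneg.mpr (hspec x hx))
    linear_combination x * this
  have hSE : S * E = S := by
    conv_lhs => enter [1]; rw [← cfc_id' ℝ S]
    conv_rhs => rw [← cfc_id' ℝ S]
    rw [hE, ← cfc_mul _ _ S (hc _) (hc _)]
    refine cfc_congr fun x hx => ?_
    rcases eq_or_ne x 0 with rfl | hx0
    · simp
    · field_simp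
  have hE1 : E ≤ 1 := by
    refine cfc_le_one _ S fun x hx => ?_
    rcases eq_or_ne x 0 with rfl | hx0
    · simp
    · rw [mul_inv_cancel₀ hx0]
  have hRER : R * E * R = A := hR.conj_eq_of_mul_self_le hAS hRA (hsa _) hSE
  have hRTR : R * (T * T) * R ≤ 1 := by
    have h1 : (R * T)ᴴ * (R * T) ≤ 1 := by
      refine le_trans ?_ hE1
      have := (le_iff.mp hAS).mul_mul_conjTranspose_same T
      rw [hTsa.eq, mul_sub, sub_mul, ← hRA, hTST] at this
      rw [le_iff, conjTranspose_mul, hR.eq, hTsa.eq]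
      simpa [mul_assoc] using this
    have h2 := mul_conjTranspose_le_one h1
    rw [conjTranspose_mul, hR.eq, hTsa.eq] at h2
    simpa [mul_assoc] using h2
  have hM : (K * A * K).PosSemidef := by
    have := hA.mul_mul_conjTranspose_same K
    rwa [hKsa.eq] at this
  have hM' : (R * (K * K) * R).IsHermitian := by
    have : (R * K * (R * K)ᴴ) = R * (K * K) * R := by
      rw [conjTranspose_mul, hR.eq, hKsa.eq]
      simp [mul_assoc]
    rw [← this]
    exact isHermitian_mul_conjTranspose_self _
  have heig : hM.1.eigenvalues = hM'.eigenvalues := by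
    rw [IsHermitian.eigenvalues_eq_eigenvalues_iff]
    have h1 : K * A * K = (K * R) * (R * K) := by rw [← hRA]; simp [mul_assoc]
    have h2 : R * (K * K) * R = (R * K) * (K * R) := by simp [mul_assoc]
    rw [h1, h2, charpoly_mul_comm]
  refine hN.le_of_eigenvalues_le hA.1 hM.1 (fun i => hg_nonneg _ (hA.eigenvalues_nonneg i))
    fun i => ?_
  obtain ⟨α, β, hα, hβ, ht, hline⟩ :=
    hg.exists_supporting_line hg_nonneg hg0 (hA.eigenvalues_nonneg i)
  rw [heig, ← ht]
  refine hA.1.eigenvalues_affine_le hM' hα ?_ i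
  have hfun : α • E - β • (T * T) ≤ K * K := by
    rw [hTT, hKK, hE, ← cfc_smul α _ S (hc _), ← cfc_smul β _ S (hc _),
      ← cfc_sub _ _ S (hc _) (hc _)]
    refine cfc_mono (fun x hx => ?_) (hc _) (hc _)
    rcases (hspec x hx).eq_or_lt with rfl | hx0
    · simp
    · have := div_le_div_of_nonneg_right (hline x hx0.le) hx0.le
      calc _ = (α * x - β) / x := by simp only [smul_eq_mul]; ring
        _ ≤ _ := this
  have hconj := (le_iff.mp hfun).mul_mul_conjTranspose_same R
  have hβ' := (le_iff.mp hRTR).smul hβ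
  rw [le_iff]
  convert hconj.add hβ' using 1
  rw [hR.eq, ← hRER]
  simp only [mul_sub, sub_mul, Matrix.mul_smul, Matrix.smul_mul, smul_sub]
  abel

end IsSymmetricAntiNorm

/-- If `g : [0,∞) → [0,∞)` is convex with `g(0)=0`, then every symmetric
anti-norm satisfies `‖g(A+B)‖_! ≥ ‖g(A)‖_! + ‖g(B)‖_!` for positive semidefinite `A, B`. -/
theorem antiNorm_convex_superadditive {n : ℕ} (g : ℝ → ℝ)
    (hg_nonneg : ∀ x ∈ Set.Ici (0:ℝ), 0 ≤ g x)
    (hg_convex : ConvexOn ℝ (Set.Ici 0) g)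
    (hg0 : g 0 = 0)
    (A B : Matrix (Fin n) (Fin n) ℂ) (hA : A.PosSemidef) (hB : B.PosSemidef)
    (N : Matrix (Fin n) (Fin n) ℂ → ℝ) (hN : IsSymmetricAntiNorm N) :
    N (cfc g A) + N (cfc g B) ≤ N (cfc g (A + B)) := by
  have hAB : (A + B).PosSemidef := hA.add hB
  set S := A + B with hS
  have hc : ∀ f : ℝ → ℝ, ContinuousOn f (spectrum ℝ S) := fun f =>
    S.finite_real_spectrum.continuousOn f
  have hSsa : IsSelfAdjoint S := hAB.isHermitian
  have hspec : ∀ x ∈ spectrum ℝ S, 0 ≤ x := fun x hx => spectrum_nonneg_of_nonneg hAB.nonneg hx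
  have h1 := hN.cfc_le_conj hg_nonneg hg_convex hg0 hA
    (show A ≤ S from le_add_of_nonneg_right hB.nonneg)
  have h2 := hN.cfc_le_conj hg_nonneg hg_convex hg0 hB
    (show B ≤ S from le_add_of_nonneg_left hA.nonneg)
  set K := cfc (fun x => √(g x / x)) S with hK
  have hKsa : K.IsHermitian := cfc_predicate _ S
  have hKSK : K * A * K + K * B * K = cfc g S := by
    rw [← add_mul, ← mul_add, ← hS]
    conv_lhs => enter [1, 2]; rw [← cfc_id' ℝ S]
    rw [hK, ← cfc_mul _ _ S (hc _) (hc _), ← cfc_mul _ _ S (hc _) (hc _)]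
    refine cfc_congr fun x hx => ?_
    have := Real.mul_self_sqrt (div_nonneg (hg_nonneg x (hspec x hx)) (hspec x hx))
    rcases eq_or_ne x 0 with rfl | hx0
    · simp [hg0]
    · calc _ = x * (√(g x / x) * √(g x / x)) := by ring
        _ = g x := by rw [this]; field_simp
  have hKA := hA.mul_mul_conjTranspose_same K
  have hKB := hB.mul_mul_conjTranspose_same K
  rw [hKsa.eq] at hKA hKB
  have h3 := hN.2.2.1 _ _ hKA hKB
  rw [hKSK] at h3
  linarith
end

section
/- Let f : [0,∞) → [0,∞) be concave and let p ∈ (1,∞) be such that f^p is superadditive, i.e. f(a+b)^p ≥ f(a)^p + f(b)^p for all a, b ≥ 0. Then for all n×n positive semidefinite complex matrices A, B and every symmetric anti-norm ‖·‖_!, ‖f(A+B)‖_!^p ≥ ‖f(A)‖_!^p + ‖f(B)‖_!^p. -/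
open scoped Matrix ComplexOrder

namespace Matrix

variable {k : Type*} [Fintype k] [DecidableEq k]

/-- The entrywise squared modulus of a unitary matrix is doubly stochastic. -/
theorem normSq_mem_doublyStochastic {V : Matrix k k ℂ} (hV : V ∈ unitaryGroup k ℂ) :
    V.map Complex.normSq ∈ doublyStochastic ℝ k := by
  rw [mem_doublyStochastic_iff_sum]
  refine ⟨fun i j => Complex.normSq_nonneg _, fun i => ?_, fun j => ?_⟩
  · have h := congrFun (congrFun (mem_unitaryGroup_iff.1 hV) i) i
    simp only [mul_apply, star_apply, one_apply_eq, RCLike.star_def, Complex.mul_conj] at h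
    exact_mod_cast h
  · have h := congrFun (congrFun (mem_unitaryGroup_iff'.1 hV) j) j
    simp only [mul_apply, star_apply, one_apply_eq, RCLike.star_def,
      ← Complex.normSq_eq_conj_mul_self] at h
    exact_mod_cast h

/-- A doubly stochastic matrix maps a vector into the convex hull of its permutations. -/
theorem mulVec_mem_convexHull_perm {M : Matrix k k ℝ} (hM : M ∈ doublyStochastic ℝ k)
    (a : k → ℝ) :
    M *ᵥ a ∈ convexHull ℝ (Set.range fun σ : Equiv.Perm k => a ∘ σ) := by
  obtain ⟨w, hw, hw1, rfl⟩ := exists_eq_sum_perm_of_mem_doublyStochastic hM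
  rw [sum_mulVec]
  simp only [smul_mulVec, permMatrix_mulVec]
  exact (convex_convexHull ℝ _).sum_mem (fun σ _ => hw σ) hw1
    fun σ _ => subset_convexHull ℝ _ ⟨σ, rfl⟩

/-- Schur: the diagonal of a Hermitian matrix in any orthonormal basis lies in the convex hull of
the permutations of its eigenvalues. -/
theorem IsHermitian.diag_conj_mem_convexHull {A W : Matrix k k ℂ} (hA : A.IsHermitian)
    (hW : W ∈ unitaryGroup k ℂ) :
    (fun i => ((Wᴴ * A * W) i i).re) ∈
      convexHull ℝ (Set.range fun σ : Equiv.Perm k => hA.eigenvalues ∘ σ) := by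
  set V : Matrix k k ℂ := Wᴴ * hA.eigenvectorUnitary with hV
  have hVu : V ∈ unitaryGroup k ℂ :=
    mul_mem (Unitary.star_mem hW) hA.eigenvectorUnitary.2
  have hconj : Wᴴ * A * W = V * diagonal (RCLike.ofReal ∘ hA.eigenvalues) * Vᴴ := by
    conv_lhs => rw [hA.spectral_theorem, Unitary.conjStarAlgAut_apply]
    simp [hV, conjTranspose_mul, Matrix.mul_assoc, star_eq_conjTranspose]
  convert mulVec_mem_convexHull_perm (normSq_mem_doublyStochastic hVu) hA.eigenvalues using 1
  ext i
  rw [hconj, mul_apply]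
  simp only [mul_diagonal, conjTranspose_apply, mulVec, dotProduct, Complex.re_sum, map_apply,
    RCLike.star_def, Function.comp_apply]
  refine Finset.sum_congr rfl fun j _ => ?_
  simp [Complex.normSq_apply]
  ring

/-- The eigenvalue functions of two Hermitian matrices are ordered the same way. -/
theorem IsHermitian.monovary_eigenvalues {A B : Matrix k k ℂ} (hA : A.IsHermitian)
    (hB : B.IsHermitian) : Monovary hA.eigenvalues hB.eigenvalues := fun _ _ h =>
  hA.eigenvalues₀_antitone (hB.eigenvalues₀_antitone.reflect_lt h).le

end Matrix

/-- Two similarly ordered real tuples can be rearranged simultaneously so as to be ordered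
similarly to any third one. -/
theorem Monovary.exists_perm_monovary {n : ℕ} {a b : Fin n → ℝ} (hab : Monovary a b)
    (w : Fin n → ℝ) :
    ∃ π : Equiv.Perm (Fin n), Monovary (a ∘ π) w ∧ Monovary (b ∘ π) w := by
  set σ := Tuple.sort (a + b)
  set τ := Tuple.sort w
  have hσ : Monotone ((a + b) ∘ σ) := Tuple.monotone_sort _
  have hτ : Monotone (w ∘ τ) := Tuple.monotone_sort _
  have hle : ∀ i j, w i < w j → τ.symm i ≤ τ.symm j := fun i j hij =>
    (hτ.reflect_lt (by simpa using hij)).le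
  refine ⟨τ.symm.trans σ, fun i j hij => ?_, fun i j hij => ?_⟩
  all_goals
    have h := hσ (hle i j hij)
    simp only [Function.comp_apply, Pi.add_apply, Equiv.trans_apply] at h ⊢
    by_contra! hlt
  · rcases lt_or_ge (b (σ (τ.symm i))) (b (σ (τ.symm j))) with hb | hb
    · exact (hab hb).not_gt hlt
    · linarith
  · have := hab hlt
    linarith

/-- The sum of vectors in the permutation hulls of two similarly ordered tuples lies in the
permutation hull of the sum of the tuples. -/
theorem Monovary.add_mem_convexHull_perm {n : ℕ} {a b x y : Fin n → ℝ} (hab : Monovary a b)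
    (hx : x ∈ convexHull ℝ (Set.range fun σ : Equiv.Perm (Fin n) => a ∘ σ))
    (hy : y ∈ convexHull ℝ (Set.range fun σ : Equiv.Perm (Fin n) => b ∘ σ)) :
    x + y ∈ convexHull ℝ (Set.range fun σ : Equiv.Perm (Fin n) => (a + b) ∘ σ) := by
  by_contra hxy
  obtain ⟨φ, u, hφ, hu⟩ := geometric_hahn_banach_closed_point (convex_convexHull ℝ _)
    ((Set.finite_range _).isClosed_convexHull ℝ) hxy
  set w : Fin n → ℝ := fun i => φ (Pi.single i 1)
  have hφw : ∀ v : Fin n → ℝ, φ v = ∑ i, v i * w i := fun v => by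
    conv_lhs => rw [pi_eq_sum_univ' v]
    simp [w, map_sum]
  obtain ⟨π, hπa, hπb⟩ := hab.exists_perm_monovary w
  have bound : ∀ {c z : Fin n → ℝ}, Monovary (c ∘ π) w →
      z ∈ convexHull ℝ (Set.range fun σ : Equiv.Perm (Fin n) => c ∘ σ) → φ z ≤ φ (c ∘ π) := by
    intro c z hc hz
    refine convexHull_min ?_ (convex_halfSpace_le φ.toLinearMap.isLinear (φ (c ∘ π))) hz
    rintro _ ⟨σ, rfl⟩
    have h := hc.sum_comp_perm_mul_le_sum_mul (σ := σ.trans π.symm)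
    simpa [hφw] using h
  have h := hφ _ (subset_convexHull ℝ _ ⟨π, rfl⟩)
  have hadd : φ ((a + b) ∘ π) = φ (a ∘ π) + φ (b ∘ π) := by
    rw [← map_add]; rfl
  rw [map_add] at hu
  simp only [hadd] at h
  linarith [bound hπa hx, bound hπb hy]

namespace Matrix

/-- The eigenvalues of `A + B` are majorized by the sum of the similarly ordered eigenvalues of
`A` and `B`. -/
theorem IsHermitian.eigenvalues_add_mem_convexHull {n : ℕ} {A B : Matrix (Fin n) (Fin n) ℂ}
    (hA : A.IsHermitian) (hB : B.IsHermitian) :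
    (hA.add hB).eigenvalues ∈ convexHull ℝ
      (Set.range fun σ : Equiv.Perm (Fin n) => (hA.eigenvalues + hB.eigenvalues) ∘ σ) := by
  set W : Matrix (Fin n) (Fin n) ℂ := ↑(hA.add hB).eigenvectorUnitary with hW
  have hWu : W ∈ unitaryGroup (Fin n) ℂ := (hA.add hB).eigenvectorUnitary.2
  convert (hA.monovary_eigenvalues hB).add_mem_convexHull_perm
    (hA.diag_conj_mem_convexHull hWu) (hB.diag_conj_mem_convexHull hWu) using 1
  ext i
  have h := congrFun (congrFun (hA.add hB).conjStarAlgAut_star_eigenvectorUnitary i) i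
  rw [Unitary.conjStarAlgAut_star_apply, diagonal_apply_eq] at h
  have h' := congrArg Complex.re h
  rw [Matrix.mul_add, Matrix.add_mul] at h'
  simpa [star_eq_conjTranspose, hW] using h'.symm

theorem posSemidef_diagonal_ofReal {k : Type*} [Fintype k] [DecidableEq k] {v : k → ℝ}
    (hv : 0 ≤ v) :
    (diagonal (fun i => (v i : ℂ))).PosSemidef :=
  PosSemidef.diagonal fun i => by simpa using hv i

end Matrix

namespace IsSymmetricAntiNorm

open Matrix

variable {k : Type*} [Fintype k] [DecidableEq k] {N : Matrix k k ℂ → ℝ}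

theorem diagonal_nonneg (hN : IsSymmetricAntiNorm N) {v : k → ℝ} (hv : 0 ≤ v) :
    0 ≤ N (diagonal fun i => (v i : ℂ)) :=
  hN.1 _ (posSemidef_diagonal_ofReal hv)

theorem diagonal_smul (hN : IsSymmetricAntiNorm N) {c : ℝ} (hc : 0 ≤ c) {v : k → ℝ}
    (hv : 0 ≤ v) :
    N (diagonal fun i => ((c * v i : ℝ) : ℂ)) = c * N (diagonal fun i => (v i : ℂ)) := by
  rw [← hN.2.1 c hc _ (posSemidef_diagonal_ofReal hv), ← Matrix.diagonal_smul]
  congr 2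
  ext i
  simp

theorem diagonal_add_le (hN : IsSymmetricAntiNorm N) {u v : k → ℝ} (hu : 0 ≤ u) (hv : 0 ≤ v) :
    N (diagonal fun i => (u i : ℂ)) + N (diagonal fun i => (v i : ℂ)) ≤
      N (diagonal fun i => ((u i + v i : ℝ) : ℂ)) := by
  refine (hN.2.2.1 _ _ (posSemidef_diagonal_ofReal hu) (posSemidef_diagonal_ofReal hv)).trans_eq ?_
  simp [diagonal_add]

theorem diagonal_mono (hN : IsSymmetricAntiNorm N) {u v : k → ℝ} (hu : 0 ≤ u) (huv : u ≤ v) :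
    N (diagonal fun i => (u i : ℂ)) ≤ N (diagonal fun i => (v i : ℂ)) := by
  have hvu : 0 ≤ v - u := sub_nonneg.2 huv
  have h := hN.diagonal_add_le hu hvu
  have h0 := hN.diagonal_nonneg hvu
  simp only [Pi.sub_apply, add_sub_cancel] at h h0
  linarith

/-- A nonnegative combination below `v` has the corresponding combination of anti-norms below that
of `v`. -/
theorem combination_le (hN : IsSymmetricAntiNorm N) {α β : ℝ} (hα : 0 ≤ α) (hβ : 0 ≤ β)
    {u v z : k → ℝ} (hu : 0 ≤ u) (hv : 0 ≤ v) (h : ∀ i, α * u i + β * v i ≤ z i) :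
    α * N (diagonal fun i => (u i : ℂ)) + β * N (diagonal fun i => (v i : ℂ)) ≤
      N (diagonal fun i => (z i : ℂ)) := by
  have hαu : 0 ≤ fun i => α * u i := fun i => mul_nonneg hα (hu i)
  have hβv : 0 ≤ fun i => β * v i := fun i => mul_nonneg hβ (hv i)
  rw [← hN.diagonal_smul hα hu, ← hN.diagonal_smul hβ hv]
  exact (hN.diagonal_add_le hαu hβv).trans (hN.diagonal_mono (add_nonneg hαu hβv) h)

theorem diagonal_comp_perm (hN : IsSymmetricAntiNorm N) {v : k → ℝ} (hv : 0 ≤ v)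
    (σ : Equiv.Perm k) :
    N (diagonal fun i => (v (σ i) : ℂ)) = N (diagonal fun i => (v i : ℂ)) := by
  have hσ : σ.permMatrix ℂ ∈ unitaryGroup k ℂ := by
    rw [mem_unitaryGroup_iff, star_eq_conjTranspose, conjTranspose_permMatrix, ← permMatrix_mul]
    simp
  rw [← hN.2.2.2 _ _ hσ (posSemidef_diagonal_ofReal hv), conjTranspose_permMatrix]
  congr 1
  ext i j
  rw [Equiv.Perm.permMatrix, PEquiv.toMatrix_toPEquiv_mul, Equiv.Perm.permMatrix,
    PEquiv.mul_toMatrix_toPEquiv]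
  have hσj : (Equiv.symm σ⁻¹) j = σ j := rfl
  simp [diagonal_apply, hσj]

theorem cfc_eq_diagonal (hN : IsSymmetricAntiNorm N) {f : ℝ → ℝ} {A : Matrix k k ℂ}
    (hA : A.IsHermitian) (hf : ∀ i, 0 ≤ f (hA.eigenvalues i)) :
    N (cfc f A) = N (diagonal fun i => (f (hA.eigenvalues i) : ℂ)) := by
  rw [hA.cfc_eq, IsHermitian.cfc, Unitary.conjStarAlgAut_apply]
  exact hN.2.2.2 _ _ hA.eigenvectorUnitary.2 (posSemidef_diagonal_ofReal hf)

theorem concaveOn_diagonal (hN : IsSymmetricAntiNorm N) {f : ℝ → ℝ}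
    (hf0 : ∀ x ∈ Set.Ici (0 : ℝ), 0 ≤ f x) (hf : ConcaveOn ℝ (Set.Ici 0) f) :
    ConcaveOn ℝ (Set.Ici 0) fun v : k → ℝ => N (diagonal fun i => (f (v i) : ℂ)) := by
  refine ⟨convex_Ici 0, fun u hu v hv α β hα hβ hαβ => ?_⟩
  exact hN.combination_le hα hβ (fun i => hf0 _ (hu i)) (fun i => hf0 _ (hv i))
    fun i => hf.2 (hu i) (hv i) hα hβ hαβ

/-- Reduction of the noncommutative sum to the sum of the ordered eigenvalues. -/
theorem diagonal_eigenvalues_le {n : ℕ} {N : Matrix (Fin n) (Fin n) ℂ → ℝ}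
    (hN : IsSymmetricAntiNorm N) {f : ℝ → ℝ} (hf0 : ∀ x ∈ Set.Ici (0 : ℝ), 0 ≤ f x)
    (hf : ConcaveOn ℝ (Set.Ici 0) f) {A B : Matrix (Fin n) (Fin n) ℂ} (hA : A.PosSemidef)
    (hB : B.PosSemidef) :
    N (diagonal fun i => (f (hA.1.eigenvalues i + hB.1.eigenvalues i) : ℂ)) ≤
      N (cfc f (A + B)) := by
  have h0 : ∀ i, 0 ≤ hA.1.eigenvalues i + hB.1.eigenvalues i := fun i =>
    add_nonneg (hA.eigenvalues_nonneg i) (hB.eigenvalues_nonneg i)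
  rw [hN.cfc_eq_diagonal (hA.1.add hB.1) fun i => hf0 _ ((hA.add hB).eigenvalues_nonneg i)]
  obtain ⟨_, ⟨σ, rfl⟩, hσ⟩ := (hN.concaveOn_diagonal hf0 hf).exists_le_of_mem_convexHull
    (by rintro _ ⟨σ, rfl⟩; exact fun i => h0 (σ i))
    (hA.1.eigenvalues_add_mem_convexHull hB.1)
  exact (hN.diagonal_comp_perm (fun i => hf0 _ (h0 i)) σ).symm.trans_le hσ

end IsSymmetricAntiNorm

/-- Dual description of the `ℓ^p` norm on the positive quadrant of `ℝ²`, as a criterion. -/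
theorem add_rpow_le_rpow_of_forall_combination_le {p x y z : ℝ} (hp : 1 < p) (hx : 0 ≤ x)
    (hy : 0 ≤ y) (hz : 0 ≤ z)
    (h : ∀ α β : ℝ, 0 ≤ α → 0 ≤ β →
      (∀ u v w : ℝ, 0 ≤ u → 0 ≤ v → 0 ≤ w → u ^ p + v ^ p ≤ w ^ p → α * u + β * v ≤ w) →
      α * x + β * y ≤ z) :
    x ^ p + y ^ p ≤ z ^ p := by
  have hp0 : 0 < p := by linarith
  have hxp := Real.rpow_nonneg hx p
  have hyp := Real.rpow_nonneg hy p
  rcases (add_nonneg hxp hyp).eq_or_lt with h0 | hpos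
  · rw [← h0]; exact Real.rpow_nonneg hz p
  set T := (x ^ p + y ^ p) ^ (1 / p) with hT
  have hTpos : 0 < T := Real.rpow_pos_of_pos hpos _
  have hTp : T ^ p = x ^ p + y ^ p := by
    rw [hT, ← Real.rpow_mul hpos.le, one_div_mul_cancel hp0.ne', Real.rpow_one]
  have hpq := Real.HolderConjugate.conjExponent hp
  set q := p.conjExponent
  have hq : (p - 1) * q = p := hpq.sub_one_mul_conj
  have hxT : 0 ≤ x / T := by positivity
  have hyT : 0 ≤ y / T := by positivity
  have hsum : (x / T) ^ p + (y / T) ^ p = 1 := by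
    rw [Real.div_rpow hx hTpos.le, Real.div_rpow hy hTpos.le, ← add_div, hTp, div_self hpos.ne']
  have key := h ((x / T) ^ (p - 1)) ((y / T) ^ (p - 1)) (by positivity) (by positivity) ?_
  · have pow_mul : ∀ t : ℝ, 0 ≤ t → (t / T) ^ (p - 1) * t = T * (t / T) ^ p := fun t ht => by
      rcases ht.eq_or_lt with rfl | ht
      · simp [hp0.ne']
      · rw [Real.rpow_sub_one (by positivity)]
        field_simp
    rw [pow_mul x hx, pow_mul y hy, ← mul_add, hsum, mul_one] at key
    rw [← hTp]
    exact Real.rpow_le_rpow hTpos.le key hp0.le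
  · intro u v w hu hv hw huv
    have hol := Real.inner_le_Lp_mul_Lq_of_nonneg Finset.univ hpq (f := ![u, v])
      (g := ![(x / T) ^ (p - 1), (y / T) ^ (p - 1)])
      (by simp [Fin.forall_fin_two, hu, hv])
      (by
        simp only [Finset.mem_univ, forall_const, Fin.forall_fin_two]
        exact ⟨Real.rpow_nonneg hxT _, Real.rpow_nonneg hyT _⟩)
    simp only [Fin.sum_univ_two, Matrix.cons_val_zero, Matrix.cons_val_one,
      ← Real.rpow_mul hxT, ← Real.rpow_mul hyT, hq, hsum, Real.one_rpow, mul_one] at hol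
    have hle : (u ^ p + v ^ p) ^ (1 / p) ≤ w := by
      rw [one_div]
      exact (Real.rpow_inv_le_iff_of_pos (by positivity) hw hp0).2 huv
    linarith

/-- If `f : [0,∞) → [0,∞)` is concave and `p ∈ (1,∞)` is such that `f^p`
is superadditive, then every symmetric anti-norm satisfies
`‖f(A+B)‖_!^p ≥ ‖f(A)‖_!^p + ‖f(B)‖_!^p` for positive semidefinite `A, B`. -/
theorem antiNorm_concave_p_superadditive {n : ℕ} (f : ℝ → ℝ)
    (hf_nonneg : ∀ x ∈ Set.Ici (0:ℝ), 0 ≤ f x)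
    (hf_concave : ConcaveOn ℝ (Set.Ici 0) f)
    (p : ℝ) (hp : 1 < p)
    (hfp_superadd : ∀ a b : ℝ, 0 ≤ a → 0 ≤ b → f a ^ p + f b ^ p ≤ f (a + b) ^ p)
    (A B : Matrix (Fin n) (Fin n) ℂ) (hA : A.PosSemidef) (hB : B.PosSemidef)
    (N : Matrix (Fin n) (Fin n) ℂ → ℝ) (hN : IsSymmetricAntiNorm N) :
    N (cfc f A) ^ p + N (cfc f B) ^ p ≤ N (cfc f (A + B)) ^ p := by
  have hA0 := hA.eigenvalues_nonneg
  have hB0 := hB.eigenvalues_nonneg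
  have hfA : ∀ i, 0 ≤ f (hA.1.eigenvalues i) := fun i => hf_nonneg _ (hA0 i)
  have hfB : ∀ i, 0 ≤ f (hB.1.eigenvalues i) := fun i => hf_nonneg _ (hB0 i)
  have hAB : ∀ i, 0 ≤ f (hA.1.eigenvalues i + hB.1.eigenvalues i) := fun i =>
    hf_nonneg _ (add_nonneg (hA0 i) (hB0 i))
  have hle := hN.diagonal_eigenvalues_le hf_nonneg hf_concave hA hB
  rw [hN.cfc_eq_diagonal hA.1 hfA, hN.cfc_eq_diagonal hB.1 hfB]
  refine add_rpow_le_rpow_of_forall_combination_le hp (hN.diagonal_nonneg hfA)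
    (hN.diagonal_nonneg hfB) ((hN.diagonal_nonneg hAB).trans hle) fun α β hα hβ hαβ => ?_
  exact (hN.combination_le hα hβ hfA hfB fun i => hαβ _ _ _ (hfA i) (hfB i) (hAB i)
    (hfp_superadd _ _ (hA0 i) (hB0 i))).trans hle
end

section
/- Let g(t) = ∑_{k=0}^m a_k t^k be a polynomial of degree m with all coefficients a_k ≥ 0 (and a_m > 0). Then for all n×n positive semidefinite complex matrices A, B and every symmetric norm ‖·‖ on M_n(ℂ), ‖g(A+B)‖^{1/m} ≤ ‖g(A)‖^{1/m} + ‖g(B)‖^{1/m}. -/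
open scoped Matrix ComplexOrder

open Polynomial Unitary

namespace IsSymmetricNorm

variable {k : Type*} [Fintype k] [DecidableEq k] {N : Matrix k k ℂ → ℝ}

theorem map_zero (hN : IsSymmetricNorm N) : N 0 = 0 := by
  simpa using hN.2.1 0 0

theorem nonneg (hN : IsSymmetricNorm N) (A : Matrix k k ℂ) : 0 ≤ N A := by
  have h := hN.1 A ((-1 : ℂ) • A)
  rw [hN.2.1] at h
  simp only [neg_smul, one_smul, add_neg_cancel, hN.map_zero, norm_neg, norm_one, one_mul] at h
  linarith

theorem sum_le (hN : IsSymmetricNorm N) {ι : Type*} (s : Finset ι) (f : ι → Matrix k k ℂ) :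
    N (∑ i ∈ s, f i) ≤ ∑ i ∈ s, N (f i) :=
  Finset.le_sum_of_subadditive N hN.map_zero.le hN.1 s f

theorem real_smul (hN : IsSymmetricNorm N) {c : ℝ} (hc : 0 ≤ c) (A : Matrix k k ℂ) :
    N (c • A) = c * N A := by
  have h := hN.2.1 (c : ℂ) A
  rwa [Complex.norm_real, Real.norm_of_nonneg hc, Complex.coe_smul] at h

theorem conj_unitary_s15 (hN : IsSymmetricNorm N) (u : unitary (Matrix k k ℂ)) (A : Matrix k k ℂ) :
    N (conjStarAlgAut ℝ _ u A) = N A := by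
  rw [conjStarAlgAut_apply]
  exact hN.2.2.2 A u _ u.2 (star u).2

theorem diagonal_mem_unitaryGroup {d : k → ℂ} (hd : ∀ i, d i * star (d i) = 1) :
    Matrix.diagonal d ∈ Matrix.unitaryGroup k ℂ := by
  rw [Matrix.mem_unitaryGroup_iff, Matrix.star_eq_conjTranspose, Matrix.diagonal_conjTranspose,
    Matrix.diagonal_mul_diagonal, ← Matrix.diagonal_one]
  exact congrArg _ (funext hd)

theorem sum_sign_mul_sign {i j : k} (hij : i ≠ j) :
    ∑ s : k → ℤˣ, (((s i : ℤ) : ℂ) * ((s j : ℤ) : ℂ)) = 0 := by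
  refine Finset.sum_involution (fun s _ => Function.update s i (-s i)) ?_ ?_ ?_ ?_
  · intro s _
    simp [Function.update_of_ne hij.symm]
  · intro s _ _ h
    have := congrFun h i
    simp at this
  · simp
  · intro s _
    simp

/-- The average over all sign matrices `S` of `S * Z * S` is the diagonal part of `Z`. -/
theorem diagonal_diag_le (hN : IsSymmetricNorm N) (Z : Matrix k k ℂ) :
    N (Matrix.diagonal Z.diag) ≤ N Z := by
  set S : (k → ℤˣ) → Matrix k k ℂ := fun s => Matrix.diagonal fun i => ((s i : ℤ) : ℂ) with hS
  have hsq : ∀ s : k → ℤˣ, ∀ i, ((s i : ℤ) : ℂ) * ((s i : ℤ) : ℂ) = 1 := by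
    intro s i
    rcases Int.units_eq_one_or (s i) with h | h <;> simp [h]
  have hU : ∀ s, S s ∈ Matrix.unitaryGroup k ℂ := fun s =>
    diagonal_mem_unitaryGroup fun i => by simpa using hsq s i
  have hcard : (0 : ℝ) < Fintype.card (k → ℤˣ) := by exact_mod_cast Fintype.card_pos
  have hsum : ∑ s, S s * Z * S s = (Fintype.card (k → ℤˣ) : ℝ) • Matrix.diagonal Z.diag := by
    ext i j
    simp only [hS, Matrix.sum_apply, Matrix.mul_diagonal, Matrix.diagonal_mul, Matrix.smul_apply]
    by_cases hij : i = j
    · subst hij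
      have : ∀ s : k → ℤˣ, ((s i : ℤ) : ℂ) * Z i i * ((s i : ℤ) : ℂ) = Z i i := fun s => by
        linear_combination Z i i * hsq s i
      rw [Finset.sum_congr rfl fun s _ => this s]
      simp
    · have : ∀ s : k → ℤˣ, ((s i : ℤ) : ℂ) * Z i j * ((s j : ℤ) : ℂ)
          = ((s i : ℤ) : ℂ) * ((s j : ℤ) : ℂ) * Z i j := fun s => by ring
      rw [Finset.sum_congr rfl fun s _ => this s, ← Finset.sum_mul, sum_sign_mul_sign hij]
      simp [hij]
  have h := hN.sum_le Finset.univ fun s => S s * Z * S s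
  rw [hsum, hN.real_smul hcard.le,
    Finset.sum_congr rfl fun s _ => hN.2.2.2 Z _ _ (hU s) (hU s)] at h
  simp only [Finset.sum_const, Finset.card_univ, nsmul_eq_mul] at h
  exact le_of_mul_le_mul_left h hcard

/-- Real contractions are averages of two unit complex numbers. -/
theorem diagonal_mul_le (hN : IsSymmetricNorm N) {c : k → ℝ} (hc : ∀ i, |c i| ≤ 1) (d : k → ℂ) :
    N (Matrix.diagonal fun i => (c i : ℂ) * d i) ≤ N (Matrix.diagonal d) := by
  set u : k → ℂ := fun i => c i + Real.sqrt (1 - c i ^ 2) * Complex.I with hu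
  have hu1 : ∀ i, u i * star (u i) = 1 := by
    intro i
    have h0 : 0 ≤ 1 - c i ^ 2 := by
      have := (sq_le_one_iff_abs_le_one (c i)).2 (hc i)
      linarith
    have h1 : ((Real.sqrt (1 - c i ^ 2) : ℝ) : ℂ) ^ 2 = 1 - (c i : ℂ) ^ 2 := by
      exact_mod_cast Real.sq_sqrt h0
    simp only [hu, star_add, star_mul', Complex.star_def, Complex.conj_ofReal, Complex.conj_I]
    linear_combination h1 - ((Real.sqrt (1 - c i ^ 2) : ℝ) : ℂ) ^ 2 * Complex.I_sq
  have hU := diagonal_mem_unitaryGroup hu1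
  have hV := diagonal_mem_unitaryGroup (d := fun i => star (u i))
    fun i => by rw [star_star, mul_comm]; exact hu1 i
  have h1 := hN.2.2.2 (Matrix.diagonal d) _ _ hU (one_mem _)
  have h2 := hN.2.2.2 (Matrix.diagonal d) _ _ hV (one_mem _)
  have hsum : Matrix.diagonal u * Matrix.diagonal d * 1
      + Matrix.diagonal (fun i => star (u i)) * Matrix.diagonal d * 1
      = (2 : ℝ) • Matrix.diagonal fun i => (c i : ℂ) * d i := by
    simp only [mul_one, Matrix.diagonal_mul_diagonal, Matrix.diagonal_add, ← Matrix.diagonal_smul]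
    congr 1
    ext i
    simp only [hu, star_add, star_mul', Complex.star_def, Complex.conj_ofReal, Complex.conj_I,
      Pi.smul_apply, Complex.real_smul]
    push_cast
    ring
  have h := hN.1 (Matrix.diagonal u * Matrix.diagonal d * 1)
    (Matrix.diagonal (fun i => star (u i)) * Matrix.diagonal d * 1)
  rw [hsum, h1, h2, hN.real_smul zero_le_two] at h
  linarith

theorem diagonal_le_of_le_diag (hN : IsSymmetricNorm N) {d : k → ℝ} {Z : Matrix k k ℂ}
    (hd : ∀ i, 0 ≤ d i) (hZ : ∀ i, (d i : ℂ) ≤ Z i i) :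
    N (Matrix.diagonal fun i => (d i : ℂ)) ≤ N Z := by
  refine le_trans ?_ (hN.diagonal_diag_le Z)
  have hre : ∀ i, ((Z i i).re : ℂ) = Z i i := fun i =>
    Complex.ext rfl (by simpa using (Complex.le_def.1 (hZ i)).2)
  have hle : ∀ i, d i ≤ (Z i i).re := fun i => by simpa using (Complex.le_def.1 (hZ i)).1
  have h := hN.diagonal_mul_le (c := fun i => d i / (Z i i).re) (fun i => by
    rw [abs_of_nonneg (div_nonneg (hd i) ((hd i).trans (hle i)))]
    exact div_le_one_of_le₀ (hle i) ((hd i).trans (hle i))) Z.diag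
  suffices heq : (fun i => (d i : ℂ)) = fun i => ((d i / (Z i i).re : ℝ) : ℂ) * Z.diag i by
    rwa [heq]
  ext i
  rw [Matrix.diag_apply, ← hre i, Complex.ofReal_re]
  norm_cast
  rcases ((hd i).trans (hle i)).eq_or_lt with h0 | h0
  · have := hle i
    rw [← h0] at this ⊢
    simpa using le_antisymm this (hd i)
  · field_simp

end IsSymmetricNorm

namespace Matrix.PosSemidef

variable {k : Type*} [Fintype k] [DecidableEq k] {A : Matrix k k ℂ}

/-- Jensen's inequality for the diagonal entries of a power. -/
theorem re_diag_pow_le (hA : A.PosSemidef) (j : k) (p : ℕ) :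
    (A j j).re ^ p ≤ ((A ^ p) j j).re := by
  set U := hA.isHermitian.eigenvectorUnitary
  set α := hA.isHermitian.eigenvalues
  have key : ∀ p : ℕ, ((A ^ p) j j).re = ∑ i, ‖(U : Matrix k k ℂ) j i‖ ^ 2 * α i ^ p := by
    intro p
    have h : A ^ p = conjStarAlgAut ℂ _ U (Matrix.diagonal (fun i => ((α i : ℂ)) ^ p)) := by
      conv_lhs => rw [hA.isHermitian.spectral_theorem]
      rw [← map_pow, Matrix.diagonal_pow]
      rfl
    rw [h, conjStarAlgAut_apply, Matrix.mul_apply, Complex.re_sum]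
    refine Finset.sum_congr rfl fun i _ => ?_
    rw [Matrix.mul_diagonal, Matrix.star_apply, mul_right_comm, Complex.star_def,
      Complex.mul_conj']
    norm_cast
  have hw : ∑ i, ‖(U : Matrix k k ℂ) j i‖ ^ 2 = 1 := by
    simpa using (key 0).symm
  have h1 := key 1
  simp only [pow_one] at h1
  rw [h1, key p]
  exact Real.pow_arith_mean_le_arith_mean_pow _ _ _ (fun i _ => by positivity) hw
    (fun i _ => hA.eigenvalues_nonneg i) p

theorem eval_re_diag_le (hA : A.PosSemidef) {g : ℝ[X]} (hg : ∀ p, 0 ≤ g.coeff p) (j : k) :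
    ((g.eval (A j j).re : ℝ) : ℂ) ≤ aeval A g j j := by
  rw [aeval_eq_sum_range, eval_eq_sum_range, Matrix.sum_apply, Complex.ofReal_sum]
  refine Finset.sum_le_sum fun p _ => ?_
  have him := (Complex.le_def.1 ((hA.pow p).diag_nonneg (i := j))).2
  rw [Matrix.smul_apply, Complex.real_smul, Complex.ofReal_mul]
  refine mul_le_mul_of_nonneg_left ?_ (by exact_mod_cast hg p)
  refine Complex.le_def.2 ⟨?_, ?_⟩
  · exact_mod_cast hA.re_diag_pow_le j p
  · rw [Complex.ofReal_im]
    exact him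

end Matrix.PosSemidef

/-- The weights `θ (1/θ) ^ m` absorb a convex splitting of the argument. -/
theorem Polynomial.eval_add_le_weighted {g : ℝ[X]} (hg : ∀ p, 0 ≤ g.coeff p) {s t θ η : ℝ}
    (hs : 0 ≤ s) (ht : 0 ≤ t) (hθ : 0 < θ) (hη : 0 < η) (h : θ + η = 1) :
    g.eval (s + t) ≤ θ * θ⁻¹ ^ g.natDegree * g.eval s + η * η⁻¹ ^ g.natDegree * g.eval t := by
  simp only [eval_eq_sum_range, Finset.mul_sum, ← Finset.sum_add_distrib]
  refine Finset.sum_le_sum fun p hp => ?_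
  have hpm : p ≤ g.natDegree := Nat.lt_succ_iff.1 (Finset.mem_range.1 hp)
  have h1 : (1 : ℝ) ≤ θ⁻¹ := (one_le_inv₀ hθ).2 (by linarith)
  have h2 : (1 : ℝ) ≤ η⁻¹ := (one_le_inv₀ hη).2 (by linarith)
  have hconv := (convexOn_pow p).2 (x := θ⁻¹ * s) (Set.mem_Ici.2 (by positivity))
    (y := η⁻¹ * t) (Set.mem_Ici.2 (by positivity)) hθ.le hη.le h
  simp only [smul_eq_mul, mul_inv_cancel_left₀ hθ.ne', mul_inv_cancel_left₀ hη.ne',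
    mul_pow] at hconv
  have h3 : θ⁻¹ ^ p ≤ θ⁻¹ ^ g.natDegree := pow_le_pow_right₀ h1 hpm
  have h4 : η⁻¹ ^ p ≤ η⁻¹ ^ g.natDegree := pow_le_pow_right₀ h2 hpm
  calc g.coeff p * (s + t) ^ p
      ≤ g.coeff p * (θ * (θ⁻¹ ^ p * s ^ p) + η * (η⁻¹ ^ p * t ^ p)) :=
        mul_le_mul_of_nonneg_left hconv (hg p)
    _ ≤ g.coeff p * (θ * (θ⁻¹ ^ g.natDegree * s ^ p) + η * (η⁻¹ ^ g.natDegree * t ^ p)) := by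
        have := hg p
        gcongr
    _ = _ := by ring

theorem IsSymmetricNorm.aeval_add_le_weighted {k : Type*} [Fintype k] [DecidableEq k]
    {N : Matrix k k ℂ → ℝ} (hN : IsSymmetricNorm N) {g : ℝ[X]} (hg : ∀ p, 0 ≤ g.coeff p)
    {A B : Matrix k k ℂ} (hA : A.PosSemidef) (hB : B.PosSemidef) {θ η : ℝ}
    (hθ : 0 < θ) (hη : 0 < η) (h : θ + η = 1) :
    N (aeval (A + B) g) ≤
      θ * θ⁻¹ ^ g.natDegree * N (aeval A g) + η * η⁻¹ ^ g.natDegree * N (aeval B g) := by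
  have hAB := (hA.add hB).isHermitian
  set φ := conjStarAlgAut ℝ (Matrix k k ℂ) (star hAB.eigenvectorUnitary) with hφ
  set α := hAB.eigenvalues
  have hdiag : φ (A + B) = Matrix.diagonal (fun i => (α i : ℂ)) :=
    hAB.conjStarAlgAut_star_eigenvectorUnitary
  have hpos : ∀ {X : Matrix k k ℂ}, X.PosSemidef → (φ X).PosSemidef := fun hX =>
    hX.mul_mul_conjTranspose_same _
  have hval : aeval (φ (A + B)) g = Matrix.diagonal (fun i => ((g.eval (α i) : ℝ) : ℂ)) := by
    rw [hdiag, aeval_eq_sum_range]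
    ext i j
    simp only [Matrix.diagonal_pow, Matrix.sum_apply, Matrix.smul_apply, Matrix.diagonal_apply]
    split_ifs with hij
    · simp [eval_eq_sum_range]
    · simp
  have hα : ∀ i, α i = (φ A i i).re + (φ B i i).re := fun i => by
    have := congrArg (fun X : Matrix k k ℂ => (X i i).re) hdiag
    simpa [map_add] using this.symm
  have hnn : ∀ {X : Matrix k k ℂ}, X.PosSemidef → ∀ i, 0 ≤ (φ X i i).re := fun hX i =>
    (Complex.le_def.1 ((hpos hX).diag_nonneg (i := i))).1
  set a := θ * θ⁻¹ ^ g.natDegree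
  set b := η * η⁻¹ ^ g.natDegree
  have ha : 0 ≤ a := by positivity
  have hb : 0 ≤ b := by positivity
  have hev : ∀ {x : ℝ}, 0 ≤ x → 0 ≤ g.eval x := fun hx => by
    rw [eval_eq_sum_range]
    exact Finset.sum_nonneg fun p _ => mul_nonneg (hg p) (pow_nonneg hx p)
  have hmaj : N (aeval (φ (A + B)) g) ≤ N (a • aeval (φ A) g + b • aeval (φ B) g) := by
    rw [hval]
    refine hN.diagonal_le_of_le_diag (fun i => hev ((hA.add hB).eigenvalues_nonneg i)) fun i => ?_
    rw [hα i, Matrix.add_apply, Matrix.smul_apply, Matrix.smul_apply, Complex.real_smul,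
      Complex.real_smul]
    refine le_trans (Complex.real_le_real.2
      (eval_add_le_weighted hg (hnn hA i) (hnn hB i) hθ hη h)) ?_
    rw [Complex.ofReal_add, Complex.ofReal_mul, Complex.ofReal_mul b]
    exact add_le_add
      (mul_le_mul_of_nonneg_left ((hpos hA).eval_re_diag_le hg i) (by exact_mod_cast ha))
      (mul_le_mul_of_nonneg_left ((hpos hB).eval_re_diag_le hg i) (by exact_mod_cast hb))
  have h2 := hmaj.trans (hN.1 _ _)
  rw [hN.real_smul ha, hN.real_smul hb] at h2
  simpa only [aeval_algHom_apply, hφ, hN.conj_unitary_s15] using h2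

/-- If `g` is a real polynomial of degree `m` with all coefficients
nonnegative (and positive leading coefficient), then for positive semidefinite `A, B`
and every symmetric norm, `‖g(A+B)‖^{1/m} ≤ ‖g(A)‖^{1/m} + ‖g(B)‖^{1/m}`. -/
theorem symmetric_norm_polynomial_root_subadditive {n : ℕ} (g : Polynomial ℝ) (m : ℕ)
    (hdeg : g.natDegree = m) (hcoeff : ∀ k, 0 ≤ g.coeff k) (hlead : 0 < g.coeff m)
    (A B : Matrix (Fin n) (Fin n) ℂ) (hA : A.PosSemidef) (hB : B.PosSemidef)
    (N : Matrix (Fin n) (Fin n) ℂ → ℝ) (hN : IsSymmetricNorm N) :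
    N (Polynomial.aeval (A + B) g) ^ (1 / (m:ℝ)) ≤
      N (Polynomial.aeval A g) ^ (1 / (m:ℝ)) + N (Polynomial.aeval B g) ^ (1 / (m:ℝ)) := by
  rcases Nat.eq_zero_or_pos m with rfl | hm
  · simp
  have hm' : m ≠ 0 := hm.ne'
  subst hdeg
  set a := N (aeval A g) ^ (1 / (g.natDegree : ℝ))
  set b := N (aeval B g) ^ (1 / (g.natDegree : ℝ))
  have ha : 0 ≤ a := Real.rpow_nonneg (hN.nonneg _) _
  have hb : 0 ≤ b := Real.rpow_nonneg (hN.nonneg _) _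
  have ham : N (aeval A g) = a ^ g.natDegree := by
    simp only [a, one_div, Real.rpow_inv_natCast_pow (hN.nonneg _) hm']
  have hbm : N (aeval B g) = b ^ g.natDegree := by
    simp only [b, one_div, Real.rpow_inv_natCast_pow (hN.nonneg _) hm']
  refine le_of_forall_pos_le_add fun ε hε => ?_
  obtain ⟨x, hx⟩ : ∃ x, x = a + ε / 2 := ⟨_, rfl⟩
  obtain ⟨y, hy⟩ : ∃ y, y = b + ε / 2 := ⟨_, rfl⟩
  have hx0 : 0 < x := by linarith
  have hy0 : 0 < y := by linarith
  have h := hN.aeval_add_le_weighted hcoeff hA hB (div_pos hx0 (add_pos hx0 hy0))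
    (div_pos hy0 (add_pos hx0 hy0)) (by field_simp)
  have hle : N (aeval (A + B) g) ≤ (x + y) ^ g.natDegree := by
    refine h.trans ?_
    rw [ham, hbm]
    calc _ ≤ x / (x + y) * (x / (x + y))⁻¹ ^ g.natDegree * x ^ g.natDegree
          + y / (x + y) * (y / (x + y))⁻¹ ^ g.natDegree * y ^ g.natDegree := by
          gcongr <;> linarith
      _ = (x + y) ^ g.natDegree := by
          simp only [inv_div, div_pow]
          field_simp
  have hfin := Real.rpow_le_rpow (hN.nonneg _) hle (by positivity : 0 ≤ 1 / (g.natDegree : ℝ))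
  rw [one_div, Real.pow_rpow_inv_natCast (add_pos hx0 hy0).le hm'] at hfin
  rw [one_div]
  linarith
end

section
/- Let Λ ⊆ ℝ be an interval and let φ be a continuous real function on Λ that is C² on the interior Λ° with φ'(t) > 0 and φ''(t) < 0 on Λ°, and such that t ↦ φ'(t)/φ''(t) is convex on Λ°. Then for every interval Ω and every function f : Ω → Λ such that φ∘f is convex on Ω, the functional A ↦ φ(τ(f(A))) is convex on the convex set of n×n Hermitian complex matrices with spectrum contained in Ω, where τ = (1/n)Tr is the normalized trace. -/
open scoped Matrix ComplexOrder

/-- The normalized (real) trace `τ = (1/n) Tr` of a complex matrix. -/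
noncomputable def normalizedTrace {n : ℕ} (A : Matrix (Fin n) (Fin n) ℂ) : ℝ :=
  A.trace.re / n

/-- The inequality `φ''(m) (∑ wᵢ dᵢ)² + φ'(m) ∑ wᵢ dᵢ² / hᵢ ≥ 0` with `h = -φ'/φ''` concave and
`m = ∑ wᵢ sᵢ`, which expresses that quasi-arithmetic means generated by `φ` have positive
semidefinite Hessian. -/
theorem quasiArithmeticMean_second_deriv_nonneg {ι : Type*} [Fintype ι] {U : Set ℝ}
    {p q : ℝ → ℝ} (hp : ∀ t ∈ U, 0 < p t) (hq : ∀ t ∈ U, q t < 0)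
    (hpq : ConvexOn ℝ U (fun t => p t / q t)) {w : ι → ℝ} (hw0 : ∀ i, 0 ≤ w i)
    (hw1 : ∑ i, w i = 1) {s : ι → ℝ} (hs : ∀ i, s i ∈ U) (d : ι → ℝ) :
    0 ≤ q (∑ i, w i * s i) * (∑ i, w i * d i) ^ 2 +
      p (∑ i, w i * s i) * ∑ i, w i * (d i ^ 2 * (-q (s i) / p (s i))) := by
  have hm : ∑ i, w i * s i ∈ U := hpq.1.sum_mem (fun i _ => hw0 i) hw1 (fun i _ => hs i)
  set m := ∑ i, w i * s i
  have hh : ∀ t ∈ U, 0 < -p t / q t := fun t ht =>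
    div_pos_of_neg_of_neg (neg_neg_of_pos (hp t ht)) (hq t ht)
  have hh' : ∀ t ∈ U, 0 < -q t / p t := fun t ht => div_pos (neg_pos.2 (hq t ht)) (hp t ht)
  have hS : 0 ≤ ∑ i, w i * (d i ^ 2 * (-q (s i) / p (s i))) :=
    Finset.sum_nonneg fun i _ => mul_nonneg (hw0 i) (mul_nonneg (sq_nonneg _) (hh' _ (hs i)).le)
  have hjensen : ∑ i, w i * (-p (s i) / q (s i)) ≤ -p m / q m := by
    have := hpq.map_sum_le (t := Finset.univ) (fun i _ => hw0 i) hw1 (fun i _ => hs i)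
    simp only [smul_eq_mul] at this
    simp only [neg_div, mul_neg, Finset.sum_neg_distrib]
    exact neg_le_neg this
  have hcs : (∑ i, w i * d i) ^ 2 ≤
      (∑ i, w i * (d i ^ 2 * (-q (s i) / p (s i)))) * ∑ i, w i * (-p (s i) / q (s i)) := by
    refine Finset.sum_sq_le_sum_mul_sum_of_sq_le_mul _
      (fun i _ => mul_nonneg (hw0 i) (mul_nonneg (sq_nonneg _) (hh' _ (hs i)).le))
      (fun i _ => mul_nonneg (hw0 i) (hh _ (hs i)).le) fun i _ => le_of_eq ?_
    have := (hp _ (hs i)).ne'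
    have := (hq _ (hs i)).ne
    field_simp
  have key := hcs.trans (mul_le_mul_of_nonneg_left hjensen hS)
  rw [mul_div_assoc', le_div_iff_of_neg (hq m hm)] at key
  linarith

/-- A differentiable function with strictly positive derivative `φ'`, itself differentiable, has a
left inverse with derivative `1 / φ'`. -/
theorem hasDerivAt_leftInvOn {U : Set ℝ} (hU : IsOpen U) {φ φ' φ'' ψ : ℝ → ℝ}
    (hφ : ∀ t ∈ U, HasDerivAt φ (φ' t) t) (hφ' : ∀ t ∈ U, HasDerivAt φ' (φ'' t) t)
    (hpos : ∀ t ∈ U, 0 < φ' t) (hψ : Set.LeftInvOn ψ φ U) {x : ℝ} (hx : x ∈ φ '' U) :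
    HasDerivAt ψ (φ' (ψ x))⁻¹ x := by
  obtain ⟨t, ht, rfl⟩ := hx
  have hUt := hU.mem_nhds ht
  rw [hψ ht]
  exact ((hasStrictDerivAt_of_hasDerivAt_of_continuousAt (Filter.mem_of_superset hUt hφ)
    (hφ' t ht).continuousAt).to_local_left_inverse (hpos t ht).ne'
      (Filter.mem_of_superset hUt hψ)).hasDerivAt

/-- Convexity of the quasi-arithmetic mean `x ↦ φ (∑ wᵢ φ⁻¹(xᵢ))` on an open domain. -/
theorem convexOn_quasiArithmeticMean_of_isOpen {ι : Type*} [Fintype ι] {U : Set ℝ}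
    (hU : IsOpen U) {φ φ' φ'' ψ : ℝ → ℝ}
    (hφ : ∀ t ∈ U, HasDerivAt φ (φ' t) t) (hφ' : ∀ t ∈ U, HasDerivAt φ' (φ'' t) t)
    (hpos : ∀ t ∈ U, 0 < φ' t) (hneg : ∀ t ∈ U, φ'' t < 0)
    (hratio : ConvexOn ℝ U (fun t => φ' t / φ'' t)) (hψ : Set.LeftInvOn ψ φ U)
    {w : ι → ℝ} (hw0 : ∀ i, 0 ≤ w i) (hw1 : ∑ i, w i = 1) :
    ConvexOn ℝ (Set.univ.pi fun _ : ι => φ '' U) (fun x => φ (∑ i, w i * ψ (x i))) := by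
  have hJ : Convex ℝ (φ '' U) :=
    (hratio.1.isPreconnected.image φ fun t ht =>
      (hφ t ht).continuousAt.continuousWithinAt).ordConnected.convex
  refine ⟨convex_pi fun _ _ => hJ, fun x hx y hy a b ha hb hab => ?_⟩
  have hmaps : ∀ z ∈ φ '' U, ψ z ∈ U := by
    rintro _ ⟨t, ht, rfl⟩
    rwa [hψ ht]
  set z : ℝ → ι → ℝ := fun e i => x i + e * (y i - x i) with hz
  have hzJ : ∀ e ∈ Set.Icc (0 : ℝ) 1, ∀ i, z e i ∈ φ '' U := fun e he i => by
    have := hJ (hx i trivial) (hy i trivial) (sub_nonneg.2 he.2) he.1 (by ring)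
    simp only [smul_eq_mul] at this
    convert this using 1
    simp only [hz]; ring
  set m : ℝ → ℝ := fun e => ∑ i, w i * ψ (z e i) with hm_def
  have hmU : ∀ e ∈ Set.Icc (0 : ℝ) 1, m e ∈ U := fun e he =>
    hratio.1.sum_mem (fun i _ => hw0 i) hw1 (fun i _ => hmaps _ (hzJ e he i))
  set d : ℝ → ι → ℝ := fun e i => (φ' (ψ (z e i)))⁻¹ * (y i - x i) with hd_def
  have hzd : ∀ e i, HasDerivAt (fun e => z e i) (y i - x i) e := fun e i => by
    simpa [hz] using ((hasDerivAt_id e).mul_const (y i - x i)).const_add (x i)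
  have hψd : ∀ e ∈ Set.Icc (0 : ℝ) 1, ∀ i, HasDerivAt (fun e => ψ (z e i)) (d e i) e :=
    fun e he i => (hasDerivAt_leftInvOn hU hφ hφ' hpos hψ (hzJ e he i)).comp e (hzd e i)
  have hmd : ∀ e ∈ Set.Icc (0 : ℝ) 1, HasDerivAt m (∑ i, w i * d e i) e := fun e he =>
    HasDerivAt.fun_sum fun i _ => (hψd e he i).const_mul (w i)
  have hdd : ∀ e ∈ Set.Icc (0 : ℝ) 1, ∀ i, HasDerivAt (fun e => d e i)
      (d e i ^ 2 * (-φ'' (ψ (z e i)) / φ' (ψ (z e i)))) e := fun e he i => by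
    have hU' := hmaps _ (hzJ e he i)
    have hne := (hpos _ hU').ne'
    have h1 : HasDerivAt (fun e => φ' (ψ (z e i))) (φ'' (ψ (z e i)) * d e i) e :=
      (hφ' _ hU').comp e (hψd e he i)
    refine ((h1.fun_inv hne).mul_const (y i - x i)).congr_deriv ?_
    simp only [hd_def]
    field_simp
  have hconv : ConvexOn ℝ (Set.Icc (0 : ℝ) 1) (fun e => φ (m e)) := by
    have hcomp : ∀ e ∈ Set.Icc (0 : ℝ) 1,
        HasDerivAt (fun e => φ (m e)) (φ' (m e) * ∑ i, w i * d e i) e :=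
      fun e he => (hφ _ (hmU e he)).comp e (hmd e he)
    refine convexOn_of_hasDerivWithinAt2_nonneg (convex_Icc 0 1)
      (f' := fun e => φ' (m e) * ∑ i, w i * d e i)
      (f'' := fun e => φ'' (m e) * (∑ i, w i * d e i) ^ 2 +
        φ' (m e) * ∑ i, w i * (d e i ^ 2 * (-φ'' (ψ (z e i)) / φ' (ψ (z e i)))))
      (fun e he => (hcomp e he).continuousAt.continuousWithinAt)
      (fun e he => (hcomp e (interior_subset he)).hasDerivWithinAt)
      (fun e he => HasDerivAt.hasDerivWithinAt ?_) fun e he => ?_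
    · replace he := interior_subset he
      have h1 : HasDerivAt (fun e => φ' (m e)) (φ'' (m e) * ∑ i, w i * d e i) e :=
        (hφ' _ (hmU e he)).comp e (hmd e he)
      have h2 : HasDerivAt (fun e => ∑ i, w i * d e i)
          (∑ i, w i * (d e i ^ 2 * (-φ'' (ψ (z e i)) / φ' (ψ (z e i))))) e :=
        HasDerivAt.fun_sum fun i _ => (hdd e he i).const_mul (w i)
      exact (h1.fun_mul h2).congr_deriv (by ring)
    · exact quasiArithmeticMean_second_deriv_nonneg hpos hneg hratio hw0 hw1
        (fun i => hmaps _ (hzJ e (interior_subset he) i)) _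
  have h := hconv.2 (Set.left_mem_Icc.2 zero_le_one) (Set.right_mem_Icc.2 zero_le_one) ha hb hab
  have e0 : z 0 = x := by ext i; simp [hz]
  have e1 : z 1 = y := by ext i; simp [hz]
  have eb : z b = a • x + b • y := by
    ext i
    simp only [hz, Pi.add_apply, Pi.smul_apply, smul_eq_mul]
    rw [eq_sub_iff_add_eq.2 hab]; ring
  simpa [hm_def, e0, e1, eb] using h

/-- A left inverse of a strictly monotone function on an order-connected set is continuous
on the image. -/
theorem StrictMonoOn.continuousOn_leftInvOn {s : Set ℝ} (hs : s.OrdConnected) {φ ψ : ℝ → ℝ}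
    (hφ : StrictMonoOn φ s) (hJ : (φ '' s).OrdConnected) (hψ : Set.LeftInvOn ψ φ s) :
    ContinuousOn ψ (φ '' s) := by
  rw [continuousOn_iff_continuous_domRestrict]
  convert continuous_subtype_val.comp (hφ.orderIso φ s).symm.continuous using 1
  ext ⟨_, t, ht, rfl⟩
  have : (hφ.orderIso φ s).symm ⟨φ t, t, ht, rfl⟩ = ⟨t, ht⟩ := by
    rw [OrderIso.symm_apply_eq]; rfl
  simp [this, hψ ht]

theorem StrictMonoOn.interior_image_subset {s : Set ℝ} (hs : s.OrdConnected) {φ : ℝ → ℝ}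
    (hφ : StrictMonoOn φ s) : interior (φ '' s) ⊆ φ '' interior s := by
  intro y hy
  obtain ⟨t, ht, rfl⟩ := interior_subset hy
  obtain ⟨l, u, ⟨hl, hu⟩, hlu⟩ := mem_nhds_iff_exists_Ioo_subset.1 (mem_interior_iff_mem_nhds.1 hy)
  obtain ⟨a, hla, hat⟩ := exists_between hl
  obtain ⟨b, htb, hbu⟩ := exists_between hu
  obtain ⟨t₁, ht₁, rfl⟩ := hlu ⟨hla, hat.trans hu⟩
  obtain ⟨t₂, ht₂, rfl⟩ := hlu ⟨hl.trans htb, hbu⟩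
  have h₁ := (hφ.lt_iff_lt ht₁ ht).1 hat
  have h₂ := (hφ.lt_iff_lt ht ht₂).1 htb
  exact ⟨t, mem_interior_iff_mem_nhds.2 (Filter.mem_of_superset (Icc_mem_nhds h₁ h₂)
    (hs.out ht₁ ht₂)), rfl⟩

/-- Convexity of the quasi-arithmetic mean `x ↦ φ (∑ wᵢ φ⁻¹(xᵢ))`. -/
theorem convexOn_quasiArithmeticMean {ι : Type*} [Fintype ι] {Λ : Set ℝ}
    (hΛ : Λ.OrdConnected) {φ φ' φ'' ψ : ℝ → ℝ} (hφ_cont : ContinuousOn φ Λ)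
    (hφ_mono : StrictMonoOn φ Λ)
    (hφ : ∀ t ∈ interior Λ, HasDerivAt φ (φ' t) t)
    (hφ' : ∀ t ∈ interior Λ, HasDerivAt φ' (φ'' t) t)
    (hpos : ∀ t ∈ interior Λ, 0 < φ' t) (hneg : ∀ t ∈ interior Λ, φ'' t < 0)
    (hratio : ConvexOn ℝ (interior Λ) (fun t => φ' t / φ'' t)) (hψ : Set.LeftInvOn ψ φ Λ)
    {w : ι → ℝ} (hw0 : ∀ i, 0 ≤ w i) (hw1 : ∑ i, w i = 1) :
    ConvexOn ℝ (Set.univ.pi fun _ : ι => φ '' Λ) (fun x => φ (∑ i, w i * ψ (x i))) := by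
  have hJ : (φ '' Λ).OrdConnected :=
    (hΛ.convex.isPreconnected.image φ hφ_cont).ordConnected
  have hJ' : Convex ℝ (Set.univ.pi fun _ : ι => φ '' Λ) := convex_pi fun _ _ => hJ.convex
  have hψ_cont := hφ_mono.continuousOn_leftInvOn hΛ hJ hψ
  have hmaps : Set.MapsTo ψ (φ '' Λ) Λ := by
    rintro _ ⟨t, ht, rfl⟩
    rwa [hψ ht]
  have hmem : ∀ x ∈ (Set.univ.pi fun _ : ι => φ '' Λ), ∑ i, w i * ψ (x i) ∈ Λ := fun x hx =>
    hΛ.convex.sum_mem (fun i _ => hw0 i) hw1 (fun i _ => hmaps (hx i trivial))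
  have hM_cont : ContinuousOn (fun x : ι → ℝ => φ (∑ i, w i * ψ (x i)))
      (Set.univ.pi fun _ : ι => φ '' Λ) := by
    refine hφ_cont.comp (continuousOn_finsetSum _ fun i _ => continuousOn_const.mul ?_) hmem
    exact hψ_cont.comp (continuous_apply i).continuousOn fun x hx => hx i trivial
  refine ⟨hJ', fun x hx y hy a b ha hb hab => ?_⟩
  rcases Set.eq_empty_or_nonempty (interior Λ) with hΛe | ⟨c, hc⟩
  · have hsub : (φ '' Λ).Subsingleton := by
      refine Set.Subsingleton.image (fun s hs t ht => ?_) φ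
      by_contra hst
      have : (interior (Set.uIcc s t)).Nonempty := by
        rw [Set.uIcc, interior_Icc, Set.nonempty_Ioo]
        exact inf_lt_sup.2 hst
      exact (this.mono (interior_mono (hΛ.uIcc_subset hs ht))).ne_empty hΛe
    obtain rfl : x = y := funext fun i => hsub (hx i trivial) (hy i trivial)
    rw [← add_smul, hab, one_smul, ← add_smul, hab, one_smul]
  · have hcJ : φ c ∈ interior (φ '' Λ) := by
      have h := hasStrictDerivAt_of_hasDerivAt_of_continuousAt
        (Filter.mem_of_superset (isOpen_interior.mem_nhds hc) hφ) (hφ' c hc).continuousAt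
      rw [mem_interior_iff_mem_nhds, ← h.map_nhds_eq (hpos c hc).ne']
      exact Filter.image_mem_map (mem_interior_iff_mem_nhds.1 hc)
    have hint := hφ_mono.interior_image_subset hΛ
    set C : ι → ℝ := fun _ => φ c
    have hpath : ∀ z ∈ (Set.univ.pi fun _ : ι => φ '' Λ), ∀ δ ∈ Set.Ioo (0 : ℝ) 1,
        (1 - δ) • z + δ • C ∈ (Set.univ.pi fun _ : ι => φ '' interior Λ) :=
      fun z hz δ hδ i _ => hint <| hJ.convex.combo_self_interior_mem_interior (hz i trivial) hcJ
        (sub_nonneg.2 hδ.2.le) hδ.1 (by ring)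
    have hIoo : ∀ᶠ δ in nhdsWithin (0 : ℝ) (Set.Ioi 0), δ ∈ Set.Ioo (0 : ℝ) 1 :=
      Ioo_mem_nhdsGT one_pos
    have hlim : ∀ z ∈ (Set.univ.pi fun _ : ι => φ '' Λ),
        Filter.Tendsto (fun δ : ℝ => φ (∑ i, w i * ψ (((1 - δ) • z + δ • C) i)))
          (nhdsWithin 0 (Set.Ioi 0)) (nhds (φ (∑ i, w i * ψ (z i)))) := fun z hz => by
      refine (hM_cont z hz).tendsto.comp (tendsto_nhdsWithin_iff.2 ⟨?_, ?_⟩)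
      · have : Continuous fun δ : ℝ => (1 - δ) • z + δ • C := by fun_prop
        simpa using (this.tendsto 0).mono_left nhdsWithin_le_nhds
      · filter_upwards [hIoo] with δ hδ i _
        exact Set.image_mono interior_subset (hpath z hz δ hδ i trivial)
    refine le_of_tendsto_of_tendsto (hlim _ (hJ' hx hy ha hb hab))
      (((hlim x hx).const_smul a).add ((hlim y hy).const_smul b)) ?_
    filter_upwards [hIoo] with δ hδ
    have h := (convexOn_quasiArithmeticMean_of_isOpen isOpen_interior hφ hφ' hpos hneg hratio
      (hψ.mono interior_subset) hw0 hw1).2 (hpath x hx δ hδ) (hpath y hy δ hδ) ha hb hab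
    have e : (1 - δ) • (a • x + b • y) + δ • C =
        a • ((1 - δ) • x + δ • C) + b • ((1 - δ) • y + δ • C) := by
      obtain rfl := eq_sub_of_add_eq hab
      module
    rw [e]
    exact h

/-- The diagonal of a Hermitian matrix in any orthonormal basis is the image of its spectrum under
a doubly stochastic matrix. -/
theorem Matrix.IsHermitian.exists_doublyStochastic_diag {ι : Type*} [Fintype ι] [DecidableEq ι]
    {A : Matrix ι ι ℂ} (hA : A.IsHermitian) (U : Matrix.unitaryGroup ι ℂ) :
    ∃ S ∈ doublyStochastic ℝ ι, ∀ i,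
      (star (U : Matrix ι ι ℂ) * A * (U : Matrix ι ι ℂ)) i i =
        ((∑ j, S i j * hA.eigenvalues j : ℝ) : ℂ) := by
  set W : Matrix.unitaryGroup ι ℂ := star U * hA.eigenvectorUnitary with hW
  have h1 : (W : Matrix ι ι ℂ) * star (W : Matrix ι ι ℂ) = 1 := Unitary.mul_star_self_of_mem W.2
  have h2 : star (W : Matrix ι ι ℂ) * (W : Matrix ι ι ℂ) = 1 := Unitary.star_mul_self_of_mem W.2
  refine ⟨fun i j => Complex.normSq ((W : Matrix ι ι ℂ) i j), ?_, fun i => ?_⟩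
  · refine mem_doublyStochastic_iff_sum.2 ⟨fun i j => Complex.normSq_nonneg _, fun i => ?_,
      fun j => ?_⟩
    · have := congrFun (congrFun h1 i) i
      simp only [Matrix.mul_apply, Matrix.star_apply, Matrix.one_apply_eq, RCLike.star_def,
        Complex.mul_conj] at this
      exact_mod_cast this
    · have := congrFun (congrFun h2 j) j
      simp only [Matrix.mul_apply, Matrix.star_apply, Matrix.one_apply_eq, RCLike.star_def,
        mul_comm (starRingEnd ℂ _), Complex.mul_conj] at this
      exact_mod_cast this
  · have : star (U : Matrix ι ι ℂ) * A * (U : Matrix ι ι ℂ) =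
        (W : Matrix ι ι ℂ) * Matrix.diagonal (RCLike.ofReal ∘ hA.eigenvalues) *
          star (W : Matrix ι ι ℂ) := by
      conv_lhs => rw [hA.spectral_theorem]
      simp [hW, Unitary.conjStarAlgAut_apply, mul_assoc]
    rw [this]
    rw [Matrix.mul_apply]
    simp only [Matrix.mul_diagonal, Matrix.star_apply, RCLike.star_def, Function.comp_apply]
    push_cast
    refine Finset.sum_congr rfl fun j _ => ?_
    rw [mul_right_comm, Complex.mul_conj]
    rfl

/-- Schur convexity of the sum of a convex function, expressed through the concave inverse `φ`. -/
theorem ConcaveOn.sum_leftInvOn_doublyStochastic_le {ι : Type*} [Fintype ι] [DecidableEq ι]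
    {Λ : Set ℝ} {φ ψ : ℝ → ℝ} (hφ : ConcaveOn ℝ Λ φ) (hmono : StrictMonoOn φ Λ)
    (hJ : Convex ℝ (φ '' Λ)) (hψ : Set.LeftInvOn ψ φ Λ) {S : Matrix ι ι ℝ}
    (hS : S ∈ doublyStochastic ℝ ι) {t : ι → ℝ} (ht : ∀ j, t j ∈ Λ) :
    ∑ i, ψ (∑ j, S i j * φ (t j)) ≤ ∑ j, t j := by
  have hle : ∀ i, ψ (∑ j, S i j * φ (t j)) ≤ ∑ j, S i j * t j := fun i => by
    have hS0 : ∀ j ∈ Finset.univ, 0 ≤ S i j := fun j _ => nonneg_of_mem_doublyStochastic hS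
    have hS1 := sum_row_of_mem_doublyStochastic hS i
    obtain ⟨u, hu, hu'⟩ : ∑ j, S i j * φ (t j) ∈ φ '' Λ :=
      hJ.sum_mem hS0 hS1 fun j _ => ⟨t j, ht j, rfl⟩
    rw [← hu', hψ hu]
    refine (hmono.le_iff_le hu (hφ.1.sum_mem hS0 hS1 fun j _ => ht j)).1 ?_
    rw [hu']
    exact hφ.le_map_sum hS0 hS1 fun j _ => ht j
  refine (Finset.sum_le_sum fun i _ => hle i).trans_eq ?_
  rw [Finset.sum_comm]
  simp [← Finset.sum_mul, sum_col_of_mem_doublyStochastic hS]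

theorem normalizedTrace_cfc {n : ℕ} {A : Matrix (Fin n) (Fin n) ℂ} (hA : A.IsHermitian)
    (f : ℝ → ℝ) : normalizedTrace (cfc f A) = ∑ i, (n : ℝ)⁻¹ * f (hA.eigenvalues i) := by
  rw [normalizedTrace, hA.cfc_eq, Matrix.IsHermitian.cfc, Unitary.conjStarAlgAut_apply,
    Matrix.trace_mul_cycle, ← Finset.mul_sum]
  simp [Matrix.trace, div_eq_inv_mul]

/-- Let `φ` be continuous on an interval `Λ`, `C²` on its interior with
`φ' > 0`, `φ'' < 0` there, and such that `φ'/φ''` is convex on the interior. Then for every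
interval `Ω` and every `f : Ω → Λ` with `φ∘f` convex on `Ω`, the functional
`A ↦ φ(τ(f(A)))` is convex on Hermitian matrices with spectrum in `Ω`. -/
theorem convexity_criterion_trace_functional {n : ℕ} (hn : 0 < n)
    (Λ : Set ℝ) (hΛ : Λ.OrdConnected)
    (φ φ' φ'' : ℝ → ℝ)
    (hφ_cont : ContinuousOn φ Λ)
    (hφ_deriv : ∀ t ∈ interior Λ, HasDerivAt φ (φ' t) t)
    (hφ_deriv2 : ∀ t ∈ interior Λ, HasDerivAt φ' (φ'' t) t)
    (hφ''_cont : ContinuousOn φ'' (interior Λ))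
    (hφ'_pos : ∀ t ∈ interior Λ, 0 < φ' t)
    (hφ''_neg : ∀ t ∈ interior Λ, φ'' t < 0)
    (hratio_convex : ConvexOn ℝ (interior Λ) (fun t => φ' t / φ'' t))
    (Ω : Set ℝ) (hΩ : Ω.OrdConnected)
    (f : ℝ → ℝ) (hf_maps : ∀ x ∈ Ω, f x ∈ Λ)
    (hφf_convex : ConvexOn ℝ Ω (fun x => φ (f x)))
    (A B : Matrix (Fin n) (Fin n) ℂ) (hA : A.IsHermitian) (hB : B.IsHermitian)
    (hspecA : spectrum ℝ A ⊆ Ω) (hspecB : spectrum ℝ B ⊆ Ω)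
    (l : ℝ) (hl0 : 0 ≤ l) (hl1 : l ≤ 1) :
    φ (normalizedTrace (cfc f (l • A + (1 - l) • B))) ≤
      l * φ (normalizedTrace (cfc f A)) + (1 - l) * φ (normalizedTrace (cfc f B)) := by
  have hmono : StrictMonoOn φ Λ := strictMonoOn_of_hasDerivWithinAt_pos hΛ.convex hφ_cont
    (fun t ht => (hφ_deriv t ht).hasDerivWithinAt) hφ'_pos
  have hconc : ConcaveOn ℝ Λ φ := concaveOn_of_hasDerivWithinAt2_nonpos hΛ.convex hφ_cont
    (fun t ht => (hφ_deriv t ht).hasDerivWithinAt)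
    (fun t ht => (hφ_deriv2 t ht).hasDerivWithinAt) (fun t ht => (hφ''_neg t ht).le)
  have hn' : (n : ℝ) ≠ 0 := by exact_mod_cast hn.ne'
  have hw0 : ∀ _ : Fin n, (0 : ℝ) ≤ (n : ℝ)⁻¹ := fun _ => by positivity
  have hw1 : ∑ _ : Fin n, (n : ℝ)⁻¹ = 1 := by simp [hn']
  set ψ := Function.invFunOn φ Λ
  have hψ : Set.LeftInvOn ψ φ Λ := hmono.injOn.leftInvOn_invFunOn
  have hJ : Convex ℝ (φ '' Λ) := (hΛ.convex.isPreconnected.image φ hφ_cont).ordConnected.convex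
  have hψΛ : ∀ x ∈ φ '' Λ, ψ x ∈ Λ ∧ φ (ψ x) = x := by
    rintro _ ⟨t, ht, rfl⟩
    rw [hψ ht]
    exact ⟨ht, rfl⟩
  have hM := convexOn_quasiArithmeticMean hΛ hφ_cont hmono hφ_deriv hφ_deriv2 hφ'_pos hφ''_neg
    hratio_convex hψ hw0 hw1
  have hC : (l • A + (1 - l) • B).IsHermitian :=
    (hA.smul (IsSelfAdjoint.all l)).add (hB.smul (IsSelfAdjoint.all (1 - l)))
  have hαΩ : ∀ i, hA.eigenvalues i ∈ Ω := fun i => hspecA (hA.eigenvalues_mem_spectrum_real i)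
  have hβΩ : ∀ i, hB.eigenvalues i ∈ Ω := fun i => hspecB (hB.eigenvalues_mem_spectrum_real i)
  obtain ⟨S, hS, hSA⟩ := hA.exists_doublyStochastic_diag hC.eigenvectorUnitary
  obtain ⟨T, hT, hTB⟩ := hB.exists_doublyStochastic_diag hC.eigenvectorUnitary
  have hγ : ∀ i, hC.eigenvalues i = l * ∑ j, S i j * hA.eigenvalues j +
      (1 - l) * ∑ j, T i j * hB.eigenvalues j := fun i => by
    have h := congrFun (congrFun hC.conjStarAlgAut_star_eigenvectorUnitary i) i
    rw [Unitary.conjStarAlgAut_apply, Matrix.diagonal_apply_eq, Unitary.coe_star, star_star] at h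
    rw [Matrix.mul_add, Matrix.add_mul, Matrix.mul_smul, Matrix.smul_mul, Matrix.mul_smul,
      Matrix.smul_mul, Matrix.add_apply, Matrix.smul_apply, Matrix.smul_apply, hSA, hTB,
      Complex.real_smul, Complex.real_smul] at h
    exact Complex.ofReal_injective (h.symm.trans (by push_cast; rfl))
  rw [normalizedTrace_cfc hA, normalizedTrace_cfc hB, normalizedTrace_cfc hC]
  set α := hA.eigenvalues
  set β := hB.eigenvalues
  set γ := hC.eigenvalues
  have hl1' := sub_nonneg.2 hl1
  have hbound : ∀ (R : Matrix (Fin n) (Fin n) ℝ) (η : Fin n → ℝ),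
      R ∈ doublyStochastic ℝ (Fin n) → (∀ j, η j ∈ Ω) →
      (∀ i, ∑ j, R i j * η j ∈ Ω) ∧
      (∀ i, φ (f (∑ j, R i j * η j)) ≤ ∑ j, R i j * φ (f (η j))) ∧
      (∀ i, ∑ j, R i j * φ (f (η j)) ∈ φ '' Λ) ∧
      φ (∑ i, (n : ℝ)⁻¹ * ψ (∑ j, R i j * φ (f (η j)))) ≤ φ (∑ i, (n : ℝ)⁻¹ * f (η i)) := by
    intro R η hR hη
    have hR0 : ∀ i, ∀ j ∈ Finset.univ, 0 ≤ R i j :=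
      fun i j _ => nonneg_of_mem_doublyStochastic hR
    have hR1 := sum_row_of_mem_doublyStochastic hR
    have hRJ : ∀ i, ∑ j, R i j * φ (f (η j)) ∈ φ '' Λ := fun i =>
      hJ.sum_mem (hR0 i) (hR1 i) fun j _ => ⟨_, hf_maps _ (hη j), rfl⟩
    refine ⟨fun i => hφf_convex.1.sum_mem (hR0 i) (hR1 i) fun j _ => hη j,
      fun i => hφf_convex.map_sum_le (hR0 i) (hR1 i) fun j _ => hη j, hRJ, ?_⟩
    refine hmono.monotoneOn
      (hΛ.convex.sum_mem (fun i _ => hw0 i) hw1 fun i _ => (hψΛ _ (hRJ i)).1)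
      (hΛ.convex.sum_mem (fun i _ => hw0 i) hw1 fun i _ => hf_maps _ (hη i)) ?_
    simp only [smul_eq_mul, ← Finset.mul_sum]
    exact mul_le_mul_of_nonneg_left (hconc.sum_leftInvOn_doublyStochastic_le hmono hJ hψ hR
      fun j => hf_maps _ (hη j)) (by positivity)
  obtain ⟨haΩ, hax, hxJ, hxα⟩ := hbound S α hS hαΩ
  obtain ⟨hbΩ, hby, hyJ, hyβ⟩ := hbound T β hT hβΩ
  set x : Fin n → ℝ := fun i => ∑ j, S i j * φ (f (α j))
  set y : Fin n → ℝ := fun i => ∑ j, T i j * φ (f (β j))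
  have hxyJ : ∀ i, l * x i + (1 - l) * y i ∈ φ '' Λ := fun i =>
    hJ (hxJ i) (hyJ i) hl0 hl1' (by ring)
  have hγΩ : ∀ i, γ i ∈ Ω := fun i => by
    rw [hγ i]
    exact hφf_convex.1 (haΩ i) (hbΩ i) hl0 hl1' (by ring)
  have hγ_le : ∀ i, f (γ i) ≤ ψ (l * x i + (1 - l) * y i) := fun i => by
    refine (hmono.le_iff_le (hf_maps _ (hγΩ i)) (hψΛ _ (hxyJ i)).1).1 ?_
    rw [(hψΛ _ (hxyJ i)).2, hγ i]
    exact (hφf_convex.2 (haΩ i) (hbΩ i) hl0 hl1' (by ring)).trans <| add_le_add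
      (mul_le_mul_of_nonneg_left (hax i) hl0) (mul_le_mul_of_nonneg_left (hby i) hl1')
  calc φ (∑ i, (n : ℝ)⁻¹ * f (γ i))
      ≤ φ (∑ i, (n : ℝ)⁻¹ * ψ (l * x i + (1 - l) * y i)) := hmono.monotoneOn
        (hΛ.convex.sum_mem (fun i _ => hw0 i) hw1 fun i _ => hf_maps _ (hγΩ i))
        (hΛ.convex.sum_mem (fun i _ => hw0 i) hw1 fun i _ => (hψΛ _ (hxyJ i)).1)
        (Finset.sum_le_sum fun i _ => mul_le_mul_of_nonneg_left (hγ_le i) (hw0 i))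
    _ ≤ l * φ (∑ i, (n : ℝ)⁻¹ * ψ (x i)) + (1 - l) * φ (∑ i, (n : ℝ)⁻¹ * ψ (y i)) :=
        hM.2 (fun i _ => hxJ i) (fun i _ => hyJ i) hl0 hl1' (by ring)
    _ ≤ l * φ (∑ i, (n : ℝ)⁻¹ * f (α i)) + (1 - l) * φ (∑ i, (n : ℝ)⁻¹ * f (β i)) := add_le_add
        (mul_le_mul_of_nonneg_left hxα hl0) (mul_le_mul_of_nonneg_left hyβ hl1')
end
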